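/- arXiv:math/9711208 — 3 statements merged into one kernel-verified Lean document; each statement's English description precedes it below -/
import Mathlib

section
/- Let Φ : B(H) → B(H) be a bounded linear map with the property that for every A ∈ B(H) there exist a number λ_A ∈ ℂ and an automorphism τ_A of B(H) such that Φ(A) = λ_A · τ_A(A). Then there exist a number λ ∈ ℂ and an automorphism τ of B(H) such that Φ(A) = λ·τ(A) for every A ∈ B(H). -/
open scoped ZeroAtInfty

/-- An automorphism of a (not necessarily unital) algebra: a multiplicative linear bijection. -/
def IsAlgebraAutomorphism {A : Type*} [NonUnitalNonAssocSemiring A] [Module ℂ A]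
    (Φ : A → A) : Prop :=
  IsLinearMap ℂ Φ ∧ (∀ a b : A, Φ (a * b) = Φ a * Φ b) ∧ Function.Bijective Φ

section LocalAut

open InnerProductSpace

variable {H : Type*} [NormedAddCommGroup H] [InnerProductSpace ℂ H]

/-- An automorphism in the sense of `IsAlgebraAutomorphism` is an algebra equivalence. -/
lemma autEquiv {A : Type*} [Ring A] [Algebra ℂ A] {τ : A → A}
    (h : IsAlgebraAutomorphism τ) : ∃ e : A ≃ₐ[ℂ] A, ∀ a, e a = τ a := by
  obtain ⟨hl, hm, hb⟩ := h
  obtain ⟨u, hu⟩ := hb.2 1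
  have h1 : τ 1 = 1 := by
    have := hm 1 u
    rw [one_mul, hu, mul_one] at this
    exact this.symm
  refine ⟨AlgEquiv.ofLinearEquiv (LinearEquiv.ofBijective (hl.mk' τ) hb) h1 hm, fun a => rfl⟩

/-- The hypothesis, with algebra equivalences. -/
def LocAut {A : Type*} [Ring A] [Algebra ℂ A] (φ : A → A) : Prop :=
  ∀ a, ∃ (c : ℂ) (e : A ≃ₐ[ℂ] A), φ a = c • e a

/-- If `φ 1 = 0` then `φ = 0`. -/
lemma LocAut.eq_zero [CompleteSpace H] [Nontrivial H]
    {φ : (H →L[ℂ] H) →L[ℂ] (H →L[ℂ] H)} (h : LocAut φ) (h1 : φ 1 = 0) (a : H →L[ℂ] H) :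
    φ a = 0 := by
  by_contra hne
  have key : ∀ t : ℂ, ∃ (c : ℂ) (e : (H →L[ℂ] H) ≃ₐ[ℂ] (H →L[ℂ] H)), c ≠ 0 ∧
      φ a = c • e (algebraMap ℂ _ t - a) := by
    intro t
    obtain ⟨c, e, he⟩ := h (algebraMap ℂ _ t - a)
    have : φ (algebraMap ℂ _ t - a) = - φ a := by
      rw [map_sub, Algebra.algebraMap_eq_smul_one, map_smul, h1]; simp
    rw [this] at he
    refine ⟨-c, e, ?_, ?_⟩
    · intro hc
      apply hne
      have : c = 0 := by simpa using hc
      rw [this, zero_smul] at he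
      simpa using he
    · rw [neg_smul, ← he, neg_neg]
  have iu : ∀ t : ℂ, IsUnit (φ a) ↔ IsUnit (algebraMap ℂ (H →L[ℂ] H) t - a) := by
    intro t
    obtain ⟨c, e, hc, he⟩ := key t
    rw [he]
    have : c • e (algebraMap ℂ _ t - a) = Units.mk0 c hc • e (algebraMap ℂ _ t - a) := rfl
    rw [this, isUnit_smul_iff, isUnit_map_iff]
  obtain ⟨t, ht⟩ := spectrum.nonempty a
  have hs : ((‖a‖ + 1 : ℝ) : ℂ) ∉ spectrum ℂ a := by
    intro hs
    have := spectrum.norm_le_norm_of_mem hs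
    rw [Complex.norm_real, Real.norm_eq_abs] at this
    have h2 := le_abs_self (‖a‖ + 1)
    linarith
  rw [spectrum.mem_iff] at ht hs
  rw [← iu] at ht hs
  exact hs ht

/-- With `φ 1 = 1`, the map is injective. -/
lemma LocAut.inj {A : Type*} [Ring A] [Algebra ℂ A] [Nontrivial A] {φ : A →ₗ[ℂ] A}
    (h : LocAut φ) (h1 : φ 1 = 1) {a : A} (ha : φ a = 0) : a = 0 := by
  obtain ⟨c, e, he⟩ := h (a + 1)
  rw [map_add, ha, h1, zero_add] at he
  have hc : c ≠ 0 := by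
    rintro rfl
    rw [zero_smul] at he
    exact one_ne_zero he
  have h2 : e (c • (a + 1)) = e 1 := by rw [map_smul, ← he, map_one]
  have h3 := e.injective h2
  have h4 : a = (c⁻¹ - 1) • (1 : A) := by
    have : a + 1 = c⁻¹ • (1 : A) := (eq_inv_smul_iff₀ hc).2 h3
    rw [sub_smul, one_smul, ← this, add_sub_cancel_right]
  rw [h4, map_smul, h1] at ha
  rw [h4, ha]

lemma LocAut.ne {A : Type*} [Ring A] [Algebra ℂ A] [Nontrivial A] {φ : A →ₗ[ℂ] A}
    (h : LocAut φ) (h1 : φ 1 = 1) {a : A} (ha : a ≠ 0) :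
    ∃ (c : ℂ) (e : A ≃ₐ[ℂ] A), c ≠ 0 ∧ φ a = c • e a := by
  obtain ⟨c, e, he⟩ := h a
  refine ⟨c, e, ?_, he⟩
  rintro rfl
  rw [zero_smul] at he
  exact ha (h.inj h1 he)

/-- Idempotents go to idempotents. -/
lemma LocAut.idem {A : Type*} [Ring A] [Algebra ℂ A] [Nontrivial A] {φ : A →ₗ[ℂ] A}
    (h : LocAut φ) (h1 : φ 1 = 1) {p : A} (hp : p * p = p) : φ p * φ p = φ p := by
  obtain ⟨c, e, he⟩ := h p
  obtain ⟨d, e', he'⟩ := h (1 - p)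
  set q := e p with hq
  have hqq : q * q = q := by rw [hq, ← map_mul, hp]
  have hrr : e' (1 - p) * e' (1 - p) = e' (1 - p) := by
    rw [← map_mul]
    congr 1
    rw [mul_sub, sub_mul, sub_mul, hp]
    simp
  have h2 : φ (1 - p) * φ (1 - p) = d • φ (1 - p) := by
    rw [he', smul_mul_smul_comm, hrr, smul_smul]
  rw [map_sub, h1, he] at h2
  have h3 : (1 - d) • (1 : A) = (c * (2 - c - d)) • q := by
    have : (1 - c • q) * (1 - c • q) = 1 - (2 * c) • q + (c * c) • q := by
      rw [mul_sub, sub_mul, sub_mul, smul_mul_smul_comm, hqq]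
      simp only [one_mul, mul_one]
      module
    rw [this] at h2
    have h4 : (1 - d) • (1 : A) - (c * (2 - c - d)) • q =
      (1 - (2 * c) • q + (c * c) • q) - d • (1 - c • q) := by module
    rw [h2, sub_self] at h4
    exact sub_eq_zero.1 h4
  by_cases hd : d = 1
  · subst hd
    have h5 : (c * (1 - c)) • q = 0 := by
      rw [sub_self, zero_smul] at h3
      rw [h3]; congr 1; ring
    rw [he, smul_mul_smul_comm, hqq]
    have : (c * c) • q = c • q - (c * (1 - c)) • q := by module
    rw [this, h5, sub_zero]
  · have h5 : (c * (2 - c - d)) ≠ 0 := by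
      intro h0
      rw [h0, zero_smul] at h3
      rcases smul_eq_zero.1 h3 with h6 | h6
      · exact hd (sub_eq_zero.1 h6).symm
      · exact one_ne_zero h6
    have h6 : q = (((c * (2 - c - d))⁻¹ * (1 - d))) • (1 : A) := by
      rw [mul_smul, h3, smul_smul, inv_mul_cancel₀ h5, one_smul]
    have h7 : p = (((c * (2 - c - d))⁻¹ * (1 - d))) • (1 : A) := by
      apply e.injective
      rw [← hq, h6, map_smul, map_one]
    generalize ((c * (2 - c - d))⁻¹ * (1 - d)) = s at h7
    rw [h7] at hp ⊢
    rw [map_smul, h1]; exact hp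

/-- An orthonormal sequence that is total. -/
lemma exists_seq [CompleteSpace H] [TopologicalSpace.SeparableSpace H]
    (hH : ¬ FiniteDimensional ℂ H) :
    ∃ e : ℕ → H, Orthonormal ℂ e ∧ ∀ x : H, (∀ n, inner ℂ (e n) x = 0) → x = 0 := by
  obtain ⟨w, b, hb⟩ := exists_hilbertBasis ℂ H
  have hc : Countable w := by
    refine Pairwise.countable_of_isOpen_disjoint (s := fun i : w => Metric.ball (i : H) (1 / 2))
      ?_ (fun i => Metric.isOpen_ball) (fun i => ⟨i, by simp⟩)
    intro i j hij
    apply Metric.ball_disjoint_ball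
    have h0 := b.orthonormal
    rw [hb] at h0
    have h1 := h0.2 hij
    have h2 := norm_sub_sq (𝕜 := ℂ) (i : H) (j : H)
    rw [h1, h0.1 i, h0.1 j] at h2
    rw [dist_eq_norm]
    norm_num at h2 ⊢
    nlinarith [norm_nonneg ((i : H) - j)]
  have hi : Infinite w := by
    by_contra hf
    rw [not_infinite_iff_finite] at hf
    have := Fintype.ofFinite w
    exact hH (Module.Finite.of_basis b.toOrthonormalBasis.toBasis)
  obtain ⟨g⟩ := nonempty_equiv_of_countable (α := ℕ) (β := w)
  refine ⟨fun n => b (g n), b.orthonormal.comp g g.injective, fun x hx => ?_⟩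
  apply b.repr.injective
  ext i
  obtain ⟨n, rfl⟩ := g.surjective i
  rw [b.repr_apply_apply, hx n]
  simp

lemma rk_summable [CompleteSpace H] {a b : ℕ → H} (ha : ∀ n, ‖a n‖ = 1) (hb : ∀ n, ‖b n‖ = 1) :
    Summable (fun n => ((2 : ℂ)⁻¹ ^ n) • rankOne ℂ (a n) (b n)) := by
  apply Summable.of_norm
  simp only [norm_smul, norm_rankOne, ha, hb, norm_pow, norm_inv, mul_one, Complex.norm_ofNat]
  exact summable_geometric_of_lt_one (by norm_num) (by norm_num)

/-- Abstract part: two-sided alternative. -/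
lemma alternative {A : Type*} [Ring A] [Algebra ℂ A] {P : A}
    (prime : ∀ a b, a * P * b = 0 → a * P = 0 ∨ P * b = 0) (hPP : P * P = P)
    (M : Set A) (hadd : ∀ x ∈ M, ∀ y ∈ M, x + y ∈ M)
    (hsq : ∀ x ∈ M, x * x = 0) (hx : ∀ x ∈ M, P * x + x * P = x) :
    (∀ x ∈ M, P * x = 0) ∨ (∀ x ∈ M, x * P = 0) := by
  have hPxP : ∀ x ∈ M, P * x * P = 0 := by
    intro x h
    have := congrArg (P * ·) (hx x h)
    simp only [mul_add, ← mul_assoc, hPP] at this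
    simpa using this
  have hxPx : ∀ x ∈ M, x * P * x = 0 := by
    intro x h
    have h1 : x * P * x = x * (P * x + x * P) - x * x * P := by noncomm_ring
    rw [h1, hx x h, hsq x h]; simp
  have pol : ∀ x ∈ M, ∀ y ∈ M, x * P * y + y * P * x = 0 := by
    intro x h y h'
    have h1 := hxPx _ (hadd x h y h')
    have h2 : (x + y) * P * (x + y) = x * P * x + y * P * y + (x * P * y + y * P * x) := by
      noncomm_ring
    rw [h2, hxPx x h, hxPx y h'] at h1
    simpa using h1
  by_contra! hcon
  obtain ⟨⟨x, h, hx1⟩, ⟨y, h', hy1⟩⟩ := hcon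
  have h1 : x * P = 0 := (prime x x (hxPx x h)).resolve_right hx1
  have h2 := pol x h y h'
  rw [h1, zero_mul, zero_add] at h2
  rcases prime _ _ h2 with h3 | h3
  · exact hy1 h3
  · exact hx1 h3

/-- The rank one image of a rank one idempotent. -/
lemma prime_of_rank {P : H →L[ℂ] H} {u : H}
    (hr : ∀ w, ∃ c : ℂ, P w = c • u) (a b : H →L[ℂ] H) (h : a * P * b = 0) :
    a * P = 0 ∨ P * b = 0 := by
  by_contra! hcon
  obtain ⟨h1, h2⟩ := hcon
  apply h2
  ext w
  obtain ⟨c, hc⟩ := hr (b w)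
  have h3 := congrArg (fun T : H →L[ℂ] H => T w) h
  have h3' : c • a u = 0 := by simpa [hc] using h3
  have h5 : (P * b) w = c • u := hc
  rw [h5, zero_apply]
  rcases smul_eq_zero.1 h3' with h4 | h4
  · rw [h4, zero_smul]
  · exfalso
    apply h1
    ext v
    obtain ⟨d, hd⟩ := hr v
    simp [hd, h4]

/-- Ring computation. -/
lemma ring_comp {A : Type*} [Ring A] [Algebra ℂ A] {P X F Y : A} {c : ℂ}
    (hP : P * P = P) (hPX : P * X = 0) (hXP : X * P = X) (hFP : F * P = 0) (hPF : P * F = F)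
    (hPY : P * Y = 0) (hYP : Y * P = 0) (hX : X * X = 0) (hF : F * F = 0) (hY : Y * Y = c • Y)
    (h : (P + X + F + Y) * (P + X + F + Y) = (1 + c) • (P + X + F + Y)) :
    F * X = c • P ∧ X * F = Y := by
  have hXY : X * Y = 0 := by rw [← hXP, mul_assoc, hPY, mul_zero]
  have hYF : Y * F = 0 := by rw [← hPF, ← mul_assoc, hYP, zero_mul]
  have hFX' : F * X * P = F * X := by rw [mul_assoc, hXP]
  have h' : P + X + F + X * F + F * X + F * Y + Y * X + c • Y = (1 + c) • (P + X + F + Y) := by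
    rw [← h]
    simp only [mul_add, add_mul, hP, hPX, hXP, hFP, hPF, hPY, hYP, hX, hF, hY, hXY, hYF]
    abel
  have h1 := congrArg (fun z => P * z * P) h'
  simp only [mul_add, add_mul, mul_smul_comm, smul_mul_assoc, ← mul_assoc, hP, hPX, hPF, hPY,
    hFP, zero_mul, smul_zero, add_zero, hFX', mul_assoc F Y P, hYP, mul_zero] at h1
  have hFX : F * X = c • P := by
    have : P + F * X = P + c • P := by rw [h1]; module
    exact add_left_cancel this
  refine ⟨hFX, ?_⟩
  have h2 : X * F - Y = c • X - Y * X + (c • F - F * Y) := by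
    rw [hFX] at h'
    have : X * F = (P + X + F + X * F + c • P + F * Y + Y * X + c • Y)
      - (P + X + F + c • P + F * Y + Y * X + c • Y) := by abel
    rw [this, h']
    module
  have h3 := congrArg (fun z => (1 - P) * z * (1 - P)) h2
  have e1 : (1 - P) * (X * F - Y) * (1 - P) = X * F - Y := by
    simp only [mul_sub, sub_mul, one_mul, mul_one, ← mul_assoc, hPX, hPY, zero_mul, mul_assoc X F P,
      hFP, hYP, mul_zero]
    simp
  have e2 : (1 - P) * (c • X - Y * X + (c • F - F * Y)) * (1 - P) = 0 := by
    simp only [mul_sub, sub_mul, mul_add, add_mul, mul_smul_comm, smul_mul_assoc, one_mul, mul_one,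
      ← mul_assoc, hPX, hPY, zero_mul, hPF, mul_assoc Y X P, hXP, hFP, mul_assoc F Y P, hYP,
      mul_zero]
    simp
  simp only [e1, e2] at h3
  exact sub_eq_zero.1 h3

lemma rk_mul (x y z w : H) :
    rankOne ℂ x y * rankOne ℂ z w = inner ℂ y z • rankOne ℂ x w :=
  rankOne_comp_rankOne x y z w

section Struct

variable [Nontrivial H] {φ : (H →L[ℂ] H) →ₗ[ℂ] (H →L[ℂ] H)}

lemma LocAut.sq (h : LocAut φ) (h1 : φ 1 = 1) (x y : H) :
    φ (rankOne ℂ x y) * φ (rankOne ℂ x y) = inner ℂ y x • φ (rankOne ℂ x y) := by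
  by_cases hc : inner ℂ y x = 0
  · obtain ⟨c, e, he⟩ := h (rankOne ℂ x y)
    rw [he, smul_mul_smul_comm, ← map_mul, rk_mul, hc]
    simp
  · set c := inner ℂ y x with hcd
    have h2 : (c⁻¹ • rankOne ℂ x y) * (c⁻¹ • rankOne ℂ x y) = c⁻¹ • rankOne ℂ x y := by
      rw [smul_mul_smul_comm, rk_mul, smul_smul, ← hcd]
      congr 1
      field_simp
    have h3 := h.idem h1 h2
    rw [map_smul, smul_mul_smul_comm] at h3
    have h4 := congrArg ((c * c) • ·) h3
    simp only [smul_smul] at h4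
    have e1 : c * c * (c⁻¹ * c⁻¹) = 1 := by field_simp
    have e2 : c * c * c⁻¹ = c := by field_simp
    rwa [e1, e2, one_smul] at h4

lemma orth_of_idem {A : Type*} [Ring A] [Algebra ℂ A] {p q : A} (hp : p * p = p)
    (hq : q * q = q) (hpq : (p + q) * (p + q) = p + q) : p * q = 0 ∧ q * p = 0 := by
  have h1 : p * q + q * p = 0 := by
    have : p * q + q * p = (p + q) * (p + q) - p * p - q * q := by noncomm_ring
    rw [this, hpq, hp, hq]; abel
  have h2 := congrArg (p * ·) h1
  have h3 := congrArg (· * p) h1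
  simp only [mul_add, add_mul, ← mul_assoc, hp, mul_zero, zero_mul] at h2 h3
  rw [mul_assoc q p p, hp] at h3
  have h4 : p * q = q * p := by
    have : p * q - q * p = (p * q + p * q * p) - (p * q * p + q * p) := by abel
    rw [h2, h3, sub_zero] at this
    exact sub_eq_zero.1 this
  rw [h4, ← two_smul ℂ] at h1
  have h5 := (smul_eq_zero.1 h1).resolve_left two_ne_zero
  exact ⟨h4.trans h5, h5⟩

lemma LocAut.orth (h : LocAut φ) (h1 : φ 1 = 1) {x0 : H} (h0 : ‖x0‖ = 1) {x y : H}
    (hx : inner ℂ x0 x = 0) (hy : inner ℂ x0 y = 0) :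
    φ (rankOne ℂ x0 x0) * φ (rankOne ℂ x y) = 0 ∧
      φ (rankOne ℂ x y) * φ (rankOne ℂ x0 x0) = 0 := by
  have h00 : inner ℂ x0 x0 = 1 := by rw [inner_self_eq_norm_sq_to_K, h0]; simp
  have hy' : inner ℂ y x0 = 0 := inner_eq_zero_symm.1 hy
  have main : ∀ x : H, inner ℂ x0 x = 0 → inner ℂ y x ≠ 0 →
      φ (rankOne ℂ x0 x0) * φ (rankOne ℂ x y) = 0 ∧
      φ (rankOne ℂ x y) * φ (rankOne ℂ x0 x0) = 0 := by
    intro x hx hc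
    set c := inner ℂ y x with hcd
    have hp : rankOne ℂ x0 x0 * rankOne ℂ x0 x0 = rankOne ℂ x0 x0 := by
      rw [rk_mul, h00, one_smul]
    have hq : (c⁻¹ • rankOne ℂ x y) * (c⁻¹ • rankOne ℂ x y) = c⁻¹ • rankOne ℂ x y := by
      rw [smul_mul_smul_comm, rk_mul, smul_smul, ← hcd]
      congr 1
      field_simp
    have hpq : (rankOne ℂ x0 x0 + c⁻¹ • rankOne ℂ x y) * (rankOne ℂ x0 x0 + c⁻¹ • rankOne ℂ x y) =
        (rankOne ℂ x0 x0 + c⁻¹ • rankOne ℂ x y) := by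
      rw [mul_add, add_mul, add_mul, hp, hq, smul_mul_assoc, mul_smul_comm, rk_mul, rk_mul, hx, hy']
      simp
    have := h.idem h1 hpq
    rw [map_add] at this
    have h2 := orth_of_idem (h.idem h1 hp) (h.idem h1 hq) this
    rw [map_smul, mul_smul_comm, smul_mul_assoc] at h2
    have hi := inv_ne_zero hc
    exact ⟨(smul_eq_zero.1 h2.1).resolve_left hi, (smul_eq_zero.1 h2.2).resolve_left hi⟩
  by_cases hc : inner ℂ y x = 0
  · by_cases hy0 : y = 0
    · simp [hy0]
    · have hyy : inner ℂ y y ≠ 0 := inner_self_ne_zero.2 hy0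
      have m1 := main y hy hyy
      have m2 := main (x + y) (by rw [inner_add_right, hx, hy, add_zero])
        (by rw [inner_add_right, hc, zero_add]; exact hyy)
      have e : φ (rankOne ℂ x y) = φ (rankOne ℂ (x + y) y) - φ (rankOne ℂ y y) := by
        rw [← map_sub]
        congr 1
        simp
      rw [e, mul_sub, sub_mul, m1.1, m1.2, m2.1, m2.2]
      simp
  · exact main x hx hc

/-- The image of a rank one idempotent has one-dimensional range. -/
lemma LocAut.rank (h : LocAut φ) (h1 : φ 1 = 1) {x0 : H} (h0 : ‖x0‖ = 1) :
    ∃ u : H, u ≠ 0 ∧ φ (rankOne ℂ x0 x0) u = u ∧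
      ∀ w, ∃ c : ℂ, φ (rankOne ℂ x0 x0) w = c • u := by
  have hx0 : x0 ≠ 0 := by rintro rfl; simp at h0
  have h00 : inner ℂ x0 x0 = 1 := by rw [inner_self_eq_norm_sq_to_K, h0]; simp
  have hne : rankOne ℂ x0 x0 ≠ 0 := rankOne_ne_zero hx0 hx0
  have hidem : φ (rankOne ℂ x0 x0) * φ (rankOne ℂ x0 x0) = φ (rankOne ℂ x0 x0) := by
    rw [h.sq h1, h00, one_smul]
  obtain ⟨c, e, hc, he⟩ := h.ne h1 hne
  have hP : φ (rankOne ℂ x0 x0) ≠ 0 := fun hz => hne (h.inj h1 hz)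
  have hPBP : ∀ B, ∃ d : ℂ, φ (rankOne ℂ x0 x0) * B * φ (rankOne ℂ x0 x0) =
      d • φ (rankOne ℂ x0 x0) := by
    intro B
    obtain ⟨C, rfl⟩ := e.surjective B
    refine ⟨c * inner ℂ x0 (C x0), ?_⟩
    rw [he, smul_mul_assoc, smul_mul_smul_comm, ← map_mul, ← map_mul]
    have : rankOne ℂ x0 x0 * C * rankOne ℂ x0 x0 = inner ℂ x0 (C x0) • rankOne ℂ x0 x0 := by
      ext w
      simp [smul_smul, mul_comm]
    rw [this, map_smul, smul_smul, smul_smul]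
    congr 1; ring
  set P := φ (rankOne ℂ x0 x0) with hPd
  obtain ⟨v, hv⟩ : ∃ v, P v ≠ 0 := by
    by_contra! hcon
    exact hP (ContinuousLinearMap.ext hcon)
  refine ⟨P v, hv, ?_, ?_⟩
  · exact congrArg (fun T : H →L[ℂ] H => T v) hidem
  · intro w
    obtain ⟨d, hd⟩ := hPBP (rankOne ℂ w (P v))
    have h2 := congrArg (fun T : H →L[ℂ] H => T v) hd
    have h3 : inner ℂ (P v) (P v) • P w = d • P v := by simpa using h2
    have hne' : inner ℂ (P v) (P v) ≠ 0 := inner_self_ne_zero.2 hv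
    refine ⟨(inner ℂ (P v) (P v))⁻¹ * d, ?_⟩
    rw [mul_smul, ← h3, smul_smul, inv_mul_cancel₀ hne', one_smul]

end Struct

/-- If a bounded map kills all the rank one summands it kills the series. -/
lemma kill_series [CompleteSpace H] {a b : ℕ → H} (ha : ∀ n, ‖a n‖ = 1) (hb : ∀ n, ‖b n‖ = 1)
    (g : (H →L[ℂ] H) →ₗ[ℂ] (H →L[ℂ] H)) (hg : Continuous g)
    (h : ∀ n, g (rankOne ℂ (a n) (b n)) = 0) :
    g (∑' n, ((2 : ℂ)⁻¹ ^ n) • rankOne ℂ (a n) (b n)) = 0 := by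
  have h1 := (rk_summable ha hb).hasSum.map g hg
  have h2 : (⇑g ∘ fun n => ((2 : ℂ)⁻¹ ^ n) • rankOne ℂ (a n) (b n)) = fun _ => 0 := by
    funext n
    simp [h n]
  rw [h2] at h1
  exact h1.unique hasSum_zero

lemma series_apply [CompleteSpace H] {a b : ℕ → H} (ha : ∀ n, ‖a n‖ = 1)
    (hb : Orthonormal ℂ b) (m : ℕ) :
    (∑' n, ((2 : ℂ)⁻¹ ^ n) • rankOne ℂ (a n) (b n)) (b m) = ((2 : ℂ)⁻¹ ^ m) • a m := by
  have h1 := (rk_summable ha hb.1).hasSum.mapL (ContinuousLinearMap.apply ℂ H (b m))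
  have h2 : HasSum (fun n => (ContinuousLinearMap.apply ℂ H (b m))
      (((2 : ℂ)⁻¹ ^ n) • rankOne ℂ (a n) (b n))) (((2 : ℂ)⁻¹ ^ m) • a m) := by
    convert hasSum_single m ?_ using 1
    · simp [hb.1 m]
    · intro n hn
      simp [hb.2 hn]
  exact h1.unique h2

lemma series_inner [CompleteSpace H] {a b : ℕ → H} (ha : Orthonormal ℂ a)
    (hb : ∀ n, ‖b n‖ = 1) (m : ℕ) (x : H) :
    inner ℂ (a m) ((∑' n, ((2 : ℂ)⁻¹ ^ n) • rankOne ℂ (a n) (b n)) x) =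
      ((2 : ℂ)⁻¹ ^ m) * inner ℂ (b m) x := by
  have h1 := (rk_summable ha.1 hb).hasSum.mapL
    (innerSL ℂ (a m) ∘L ContinuousLinearMap.apply ℂ H x)
  have h2 : HasSum (fun n => (innerSL ℂ (a m) ∘L ContinuousLinearMap.apply ℂ H x)
      (((2 : ℂ)⁻¹ ^ n) • rankOne ℂ (a n) (b n))) (((2 : ℂ)⁻¹ ^ m) * inner ℂ (b m) x) := by
    convert hasSum_single m ?_ using 1
    · simp [ha.1 m]
    · intro n hn
      simp [ha.2 hn.symm]
  exact h1.unique h2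

set_option maxHeartbeats 1600000 in
/-- Structure on rank one operators. -/
lemma LocAut.struct [CompleteSpace H] [Nontrivial H] {φ : (H →L[ℂ] H) →ₗ[ℂ] (H →L[ℂ] H)}
    (hcont : Continuous φ) (h : LocAut φ) (h1 : φ 1 = 1) {e : ℕ → H} (he : Orthonormal ℂ e)
    (htot : ∀ x : H, (∀ n, inner ℂ (e n) x = 0) → x = 0) (x y : H) :
    φ (rankOne ℂ x (e 0)) * φ (rankOne ℂ (e 0) y) = φ (rankOne ℂ x y) ∧
    φ (rankOne ℂ (e 0) y) * φ (rankOne ℂ x (e 0)) =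
      inner ℂ y x • φ (rankOne ℂ (e 0) (e 0)) := by
  set x0 := e 0 with hx0
  have h0 : ‖x0‖ = 1 := he.1 0
  have h00 : inner ℂ x0 x0 = 1 := by rw [inner_self_eq_norm_sq_to_K, h0]; simp
  obtain ⟨u, hu, hPu, hr⟩ := h.rank h1 h0
  set P := φ (rankOne ℂ x0 x0) with hP
  have hPne : P ≠ 0 := by
    intro hz; rw [hz] at hPu; exact hu hPu.symm
  have hPP : P * P = P := by rw [hP, h.sq h1, h00, one_smul]
  have prime := prime_of_rank hr
  -- first family
  have altX := alternative prime hPP {X | ∃ x, inner ℂ x0 x = 0 ∧ X = φ (rankOne ℂ x x0)}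
    (by
      rintro _ ⟨x, hx, rfl⟩ _ ⟨y, hy, rfl⟩
      exact ⟨x + y, by rw [inner_add_right, hx, hy, add_zero], by simp⟩)
    (by
      rintro _ ⟨x, hx, rfl⟩
      rw [h.sq h1, hx, zero_smul])
    (by
      rintro _ ⟨x, hx, rfl⟩
      have h2 := h.sq h1 (x0 + x) x0
      have h3 := h.sq h1 x x0
      rw [inner_add_right, h00, hx, add_zero, one_smul] at h2
      rw [hx, zero_smul] at h3
      simp only [map_add, add_apply, mul_add, add_mul, ← hP, hPP, h3] at h2
      have : P + (P * φ (rankOne ℂ x x0) + φ (rankOne ℂ x x0) * P) = P + φ (rankOne ℂ x x0) := by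
        rw [← h2]; abel
      exact add_left_cancel this)
  have altF := alternative prime hPP {X | ∃ y, inner ℂ x0 y = 0 ∧ X = φ (rankOne ℂ x0 y)}
    (by
      rintro _ ⟨x, hx, rfl⟩ _ ⟨y, hy, rfl⟩
      exact ⟨x + y, by rw [inner_add_right, hx, hy, add_zero], by simp⟩)
    (by
      rintro _ ⟨y, hy, rfl⟩
      rw [h.sq h1, inner_eq_zero_symm.1 hy, zero_smul])
    (by
      rintro _ ⟨x, hx, rfl⟩
      have h2 := h.sq h1 x0 (x0 + x)
      have h3 := h.sq h1 x0 x
      rw [inner_add_left, h00, inner_eq_zero_symm.1 hx, add_zero, one_smul] at h2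
      rw [inner_eq_zero_symm.1 hx, zero_smul] at h3
      simp only [map_add, mul_add, add_mul, ← hP, hPP, h3] at h2
      have : P + (P * φ (rankOne ℂ x0 x) + φ (rankOne ℂ x0 x) * P) = P + φ (rankOne ℂ x0 x) := by
        rw [← h2]; abel
      exact add_left_cancel this)
  have sumX : ∀ x, inner ℂ x0 x = 0 →
      P * φ (rankOne ℂ x x0) + φ (rankOne ℂ x x0) * P = φ (rankOne ℂ x x0) := by
    intro x hx
    have h2 := h.sq h1 (x0 + x) x0
    have h3 := h.sq h1 x x0
    rw [inner_add_right, h00, hx, add_zero, one_smul] at h2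
    rw [hx, zero_smul] at h3
    simp only [map_add, add_apply, mul_add, add_mul, ← hP, hPP, h3] at h2
    have : P + (P * φ (rankOne ℂ x x0) + φ (rankOne ℂ x x0) * P) = P + φ (rankOne ℂ x x0) := by
      rw [← h2]; abel
    exact add_left_cancel this
  have sumF : ∀ x, inner ℂ x0 x = 0 →
      P * φ (rankOne ℂ x0 x) + φ (rankOne ℂ x0 x) * P = φ (rankOne ℂ x0 x) := by
    intro x hx
    have h2 := h.sq h1 x0 (x0 + x)
    have h3 := h.sq h1 x0 x
    rw [inner_add_left, h00, inner_eq_zero_symm.1 hx, add_zero, one_smul] at h2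
    rw [inner_eq_zero_symm.1 hx, zero_smul] at h3
    simp only [map_add, mul_add, add_mul, ← hP, hPP, h3] at h2
    have : P + (P * φ (rankOne ℂ x0 x) + φ (rankOne ℂ x0 x) * P) = P + φ (rankOne ℂ x0 x) := by
      rw [← h2]; abel
    exact add_left_cancel this
  have decomp : ∀ z : H, inner ℂ x0 (z - inner ℂ x0 z • x0) = 0 := by
    intro z
    rw [inner_sub_right, inner_smul_right, h00, mul_one, sub_self]
  -- `P X = 0`
  have hPX : ∀ x, inner ℂ x0 x = 0 → P * φ (rankOne ℂ x x0) = 0 := by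
    rcases altX with hX | hX
    · exact fun x hx => hX _ ⟨x, hx, rfl⟩
    exfalso
    have hb' : Orthonormal ℂ (fun n => e (n + 1)) := he.comp (· + 1) (add_left_injective 1)
    have hk := kill_series (a := fun n => e (n + 1)) (b := e) hb'.1 he.1
      (LinearMap.mulRight ℂ P ∘ₗ φ) (by
        have : Continuous fun T => φ T * P := hcont.mul continuous_const
        exact this) (by
        intro n
        have hx : inner ℂ x0 (e (n + 1)) = 0 := he.2 (by simp)
        change φ (rankOne ℂ (e (n + 1)) (e n)) * P = 0
        have hd := decomp (e n)
        set c := inner ℂ x0 (e n) with hc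
        have e1 : rankOne ℂ (e (n + 1)) (e n) =
            rankOne ℂ (e (n + 1)) (e n - c • x0) +
              (starRingEnd ℂ) c • rankOne ℂ (e (n + 1)) x0 := by
          rw [map_sub, map_smulₛₗ, sub_add_cancel]
        rw [e1, map_add, map_smul, add_mul, smul_mul_assoc, (h.orth h1 h0 hx hd).2,
          hX _ ⟨_, hx, rfl⟩]
        simp)
    set K := ∑' n, ((2 : ℂ)⁻¹ ^ n) • rankOne ℂ (e (n + 1)) (e n) with hK
    have hKx : ∀ x, K x = 0 → x = 0 := by
      intro x hx
      apply htot
      intro m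
      have := series_inner hb' he.1 m x
      rw [← hK, hx, inner_zero_right] at this
      rcases mul_eq_zero.1 this.symm with h4 | h4
      · simp at h4
      · exact h4
    have hKne : K ≠ 0 := by
      intro hz
      have := hKx x0 (by rw [hz]; rfl)
      rw [this] at h0; simp at h0
    obtain ⟨c, τ, hc, hτ⟩ := h.ne h1 hKne
    change φ K * P = 0 at hk
    rw [hτ, smul_mul_assoc] at hk
    have hk' := (smul_eq_zero.1 hk).resolve_left hc
    obtain ⟨C, hC⟩ := τ.surjective P
    rw [← hC, ← map_mul, map_eq_zero_iff _ τ.injective] at hk'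
    apply hPne
    rw [← hC, map_eq_zero_iff _ τ.injective]
    ext w
    exact hKx _ (congrArg (fun T : H →L[ℂ] H => T w) hk')
  have hXP : ∀ x, inner ℂ x0 x = 0 → φ (rankOne ℂ x x0) * P = φ (rankOne ℂ x x0) := by
    intro x hx
    have := sumX x hx
    rwa [hPX x hx, zero_add] at this
  -- the square of a sum
  have big : ∀ x y, inner ℂ x0 x = 0 → inner ℂ x0 y = 0 →
      (P + φ (rankOne ℂ x x0) + φ (rankOne ℂ x0 y) + φ (rankOne ℂ x y)) *
      (P + φ (rankOne ℂ x x0) + φ (rankOne ℂ x0 y) + φ (rankOne ℂ x y)) =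
      (1 + inner ℂ y x) •
      (P + φ (rankOne ℂ x x0) + φ (rankOne ℂ x0 y) + φ (rankOne ℂ x y)) := by
    intro x y hx hy
    have h2 := h.sq h1 (x0 + x) (x0 + y)
    have e1 : φ (rankOne ℂ (x0 + x) (x0 + y)) =
        (P + φ (rankOne ℂ x x0) + φ (rankOne ℂ x0 y) + φ (rankOne ℂ x y)) := by
      rw [hP, ← map_add, ← map_add, ← map_add]
      congr 1
      simp only [map_add, add_apply]
      abel
    have e2 : inner ℂ (x0 + y) (x0 + x) = 1 + inner ℂ y x := by
      rw [inner_add_left, inner_add_right, inner_add_right, h00, hx, inner_eq_zero_symm.1 hy]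
      ring
    rwa [e1, e2] at h2
  have hFP : ∀ y, inner ℂ x0 y = 0 → φ (rankOne ℂ x0 y) * P = 0 := by
    rcases altF with hF | hF
    swap
    · exact fun x hx => hF _ ⟨x, hx, rfl⟩
    exfalso
    have hx : inner ℂ x0 (e 1) = 0 := he.2 (by simp)
    have hb := big _ _ hx hx
    have hc : inner ℂ (e 1) (e 1) = (1 : ℂ) := by
      rw [inner_self_eq_norm_sq_to_K, he.1 1]; simp
    have hPF := hF _ ⟨_, hx, rfl⟩
    have hPX' := hPX _ hx
    have hPY := (h.orth h1 h0 hx hx).1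
    have hb2 := congrArg (fun z => P * z * P) hb
    simp only [hc, ← mul_assoc, mul_smul_comm, smul_mul_assoc] at hb2
    have e1 : P * (P + φ (rankOne ℂ (e 1) x0) + φ (rankOne ℂ x0 (e 1)) +
        φ (rankOne ℂ (e 1) (e 1))) = P := by
      rw [mul_add, mul_add, mul_add, hPP, hPF, hPX', hPY]; simp
    rw [e1, e1, hPP] at hb2
    apply hPne
    have : (1 : ℂ) • P = 0 := by
      have h5 : (1 : ℂ) • P = (1 + 1 : ℂ) • P - P := by module
      rw [h5, ← hb2, sub_self]
    simpa using this
  have hPF : ∀ y, inner ℂ x0 y = 0 → P * φ (rankOne ℂ x0 y) = φ (rankOne ℂ x0 y) := by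
    intro x hx
    have := sumF x hx
    rwa [hFP x hx, add_zero] at this
  have core : ∀ x y, inner ℂ x0 x = 0 → inner ℂ x0 y = 0 →
      φ (rankOne ℂ x0 y) * φ (rankOne ℂ x x0) = inner ℂ y x • P ∧
      φ (rankOne ℂ x x0) * φ (rankOne ℂ x0 y) = φ (rankOne ℂ x y) := by
    intro x y hx hy
    refine ring_comp hPP (hPX x hx) (hXP x hx) (hFP y hy) (hPF y hy) (h.orth h1 h0 hx hy).1
      (h.orth h1 h0 hx hy).2 ?_ ?_ (h.sq h1 x y) (big x y hx hy)
    · rw [h.sq h1, hx, zero_smul]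
    · rw [h.sq h1, inner_eq_zero_symm.1 hy, zero_smul]
  -- general vectors
  obtain ⟨a, x', hx', rfl⟩ : ∃ (a : ℂ) (x' : H), inner ℂ x0 x' = 0 ∧ x = a • x0 + x' :=
    ⟨inner ℂ x0 x, x - inner ℂ x0 x • x0, decomp x, by abel⟩
  obtain ⟨b, y', hy', rfl⟩ : ∃ (a : ℂ) (x' : H), inner ℂ x0 x' = 0 ∧ y = a • x0 + x' :=
    ⟨inner ℂ x0 y, y - inner ℂ x0 y • x0, decomp y, by abel⟩
  have hc := core x' y' hx' hy'
  have eX : φ (rankOne ℂ (a • x0 + x') x0) = a • P + φ (rankOne ℂ x' x0) := by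
    simp [hP]
  have eF : φ (rankOne ℂ x0 (b • x0 + y')) = (starRingEnd ℂ) b • P + φ (rankOne ℂ x0 y') := by
    rw [map_add, map_smulₛₗ, map_add, map_smul]
  have eY : φ (rankOne ℂ (a • x0 + x') (b • x0 + y')) =
      (a * (starRingEnd ℂ) b) • P + a • φ (rankOne ℂ x0 y') +
      (starRingEnd ℂ) b • φ (rankOne ℂ x' x0) + φ (rankOne ℂ x' y') := by
    simp only [map_add, map_smulₛₗ, add_apply, smul_apply, RingHom.id_apply, ← hP]
    module
  have eI : inner ℂ (b • x0 + y') (a • x0 + x') = (starRingEnd ℂ) b * a + inner ℂ y' x' := by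
    simp only [inner_add_left, inner_add_right, inner_smul_left, inner_smul_right, h00, hx',
      inner_eq_zero_symm.1 hy']
    ring
  constructor
  · rw [eX, eF, eY, mul_add, add_mul, add_mul, hc.2, smul_mul_smul_comm, hPP, smul_mul_assoc,
      mul_smul_comm, hPF y' hy', hXP x' hx']
    abel
  · rw [eX, eF, eI, mul_add, add_mul, add_mul, hc.1, smul_mul_smul_comm, hPP, smul_mul_assoc,
      mul_smul_comm, hFP y' hy', hPX x' hx', add_smul]
    simp

/-- The unital case: `φ` is inner. -/
lemma LocAut.inner_of_unital [CompleteSpace H] [TopologicalSpace.SeparableSpace H] [Nontrivial H]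
    (hH : ¬ FiniteDimensional ℂ H) {φ : (H →L[ℂ] H) →ₗ[ℂ] (H →L[ℂ] H)}
    (hcont : Continuous φ) (h : LocAut φ) (h1 : φ 1 = 1) :
    ∃ S : H ≃L[ℂ] H, ∀ (A : H →L[ℂ] H) (x : H), φ A (S x) = S (A x) := by
  obtain ⟨e, he, htot⟩ := exists_seq hH
  have str := h.struct hcont h1 he htot
  have h0 : ‖e 0‖ = 1 := he.1 0
  obtain ⟨u, hu, hPu, hr⟩ := h.rank h1 h0
  set Φ : (H →L[ℂ] H) →L[ℂ] (H →L[ℂ] H) := ⟨φ, hcont⟩ with hΦ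
  set S : H →L[ℂ] H := (ContinuousLinearMap.apply ℂ H u) ∘L Φ ∘L ((rankOne ℂ).flip (e 0)) with hS
  have S_apply : ∀ x, S x = φ (rankOne ℂ x (e 0)) u := fun x => rfl
  have FS : ∀ y z, φ (rankOne ℂ (e 0) y) (S z) = inner ℂ y z • u := by
    intro y z
    have := congrArg (fun T : H →L[ℂ] H => T u) (str z y).2
    simp only [mul_apply_eq_comp, smul_apply, hPu] at this
    exact this
  have ES : ∀ x y z, φ (rankOne ℂ x y) (S z) = inner ℂ y z • S x := by
    intro x y z
    rw [← (str x y).1, mul_apply_eq_comp, FS, map_smul, S_apply]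
  -- bounded below
  have hbelow : ∀ z, ‖z‖ ≤ (‖u‖⁻¹ * ‖Φ‖) * ‖S z‖ := by
    intro z
    by_cases hz : z = 0
    · simp [hz]
    have hz' : 0 < ‖z‖ := norm_pos_iff.2 hz
    have hu' : 0 < ‖u‖ := norm_pos_iff.2 hu
    have h2 : ‖φ (rankOne ℂ (e 0) z) (S z)‖ ≤ (‖Φ‖ * ‖z‖) * ‖S z‖ := by
      refine (ContinuousLinearMap.le_opNorm _ _).trans ?_
      gcongr
      refine (Φ.le_opNorm (rankOne ℂ (e 0) z)).trans ?_
      rw [norm_rankOne, h0, one_mul]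
    have hn : ‖inner ℂ z z‖ = ‖z‖ ^ 2 := by
      rw [inner_self_eq_norm_sq_to_K]; simp
    rw [FS, norm_smul, hn] at h2
    have h3 : ‖z‖ * ‖u‖ ≤ ‖Φ‖ * ‖S z‖ := by
      have : ‖z‖ * (‖z‖ * ‖u‖) ≤ ‖z‖ * (‖Φ‖ * ‖S z‖) := by linarith
      exact le_of_mul_le_mul_left this hz'
    rw [mul_assoc, ← div_eq_inv_mul, le_div_iff₀ hu']
    exact h3
  have hanti : AntilipschitzWith (Real.toNNReal (‖u‖⁻¹ * ‖Φ‖)) S := by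
    apply AddMonoidHomClass.antilipschitz_of_bound
    intro x
    rw [Real.coe_toNNReal _ (by positivity)]
    exact hbelow x
  have hclosed : IsClosed (S.range : Set H) := by
    have := hanti.isClosed_range S.uniformContinuous
    exact this
  have hker : S.ker = ⊥ := LinearMap.ker_eq_bot.2 hanti.injective
  have hrange : S.range = ⊤ := by
    have hcs : CompleteSpace S.range := hclosed.completeSpace_coe
    rw [← Submodule.orthogonal_eq_bot_iff, Submodule.eq_bot_iff]
    intro q hq
    by_contra hq0
    have hqS : ∀ x, inner ℂ q (S x) = 0 := by
      intro x
      exact inner_eq_zero_symm.1 (hq (S x) ⟨x, rfl⟩)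
    have hk := kill_series (a := e) (b := e) he.1 he.1
      (LinearMap.mulLeft ℂ (rankOne ℂ q q) ∘ₗ φ) (by
        have : Continuous fun T => rankOne ℂ q q * φ T := continuous_const.mul hcont
        exact this) (by
        intro n
        change rankOne ℂ q q * φ (rankOne ℂ (e n) (e n)) = 0
        have s1 := (str (e n) (e n)).1
        have s2 := (str (e n) (e 0)).1
        rw [← s1, ← s2]
        ext w
        simp only [mul_apply_eq_comp, rankOne_apply, zero_apply]
        obtain ⟨c, hc⟩ := hr (φ (rankOne ℂ (e 0) (e n)) w)
        rw [hc, map_smul, ← S_apply, inner_smul_right, hqS]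
        simp)
    set K := ∑' n, ((2 : ℂ)⁻¹ ^ n) • rankOne ℂ (e n) (e n) with hK
    have hKe : ∀ m, K (e m) = ((2 : ℂ)⁻¹ ^ m) • e m := fun m => series_apply he.1 he m
    have h2 : ∀ m, ((2 : ℂ)⁻¹ ^ m) ≠ 0 := fun m => pow_ne_zero _ (by norm_num)
    have hKne : K ≠ 0 := by
      intro hz
      have h3 := hKe 0
      rw [hz, zero_apply, pow_zero, one_smul] at h3
      rw [← h3] at h0; simp at h0
    obtain ⟨c, τ, hc, hτ⟩ := h.ne h1 hKne
    change rankOne ℂ q q * φ K = 0 at hk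
    rw [hτ, mul_smul_comm] at hk
    have hk' := (smul_eq_zero.1 hk).resolve_left hc
    obtain ⟨C, hC⟩ := τ.surjective (rankOne ℂ q q)
    rw [← hC, ← map_mul, map_eq_zero_iff _ τ.injective] at hk'
    have hCe : ∀ m, C (e m) = 0 := by
      intro m
      have h4 := congrArg (fun T : H →L[ℂ] H => T (e m)) hk'
      simp only [mul_apply_eq_comp, hKe, map_smul, zero_apply] at h4
      exact (smul_eq_zero.1 h4).resolve_left (h2 m)
    have hCz : C = 0 := by
      have : ContinuousLinearMap.adjoint C = 0 := by
        ext w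
        apply htot
        intro n
        rw [ContinuousLinearMap.adjoint_inner_right, hCe, inner_zero_left]
      simpa using this
    rw [hCz, map_zero] at hC
    exact rankOne_ne_zero (𝕜 := ℂ) hq0 hq0 hC.symm
  refine ⟨ContinuousLinearEquiv.ofBijective S hker hrange, ?_⟩
  have hSsurj : Function.Surjective S := LinearMap.range_eq_top.1 hrange
  intro A w
  rw [ContinuousLinearEquiv.coeFn_ofBijective]
  by_cases hw : w = 0
  · simp [hw]
  -- shift by a large scalar
  obtain ⟨z, hz⟩ : ∃ z : ℂ, ∀ v, φ A v = z • v → v = 0 := by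
    refine ⟨((‖φ A‖ + 1 : ℝ) : ℂ), fun v hv => ?_⟩
    by_contra hv0
    have h2 := (φ A).le_opNorm v
    rw [hv, norm_smul, Complex.norm_real, Real.norm_eq_abs,
      abs_of_nonneg (by positivity)] at h2
    have : 0 < ‖v‖ := norm_pos_iff.2 hv0
    linarith
  set A' := A - z • (1 : H →L[ℂ] H) with hA'
  have hφA' : ∀ v, φ A' v = φ A v - z • v := by
    intro v
    rw [hA', map_sub, map_smul, h1]
    simp
  have hinj : ∀ v, φ A' v = 0 → v = 0 := by
    intro v hv
    rw [hφA', sub_eq_zero] at hv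
    exact hz v hv
  have key : ∀ y, inner ℂ y w = 1 → ∃ w', φ A' (S w') = S (A' w) ∧ inner ℂ y w' = 1 := by
    intro y hy
    set T := A' - rankOne ℂ (A' w) y with hT
    have hTw : T w = 0 := by simp [hT, hy]
    have hTC : T * rankOne ℂ w w = 0 := by
      ext v
      simp [hTw]
    obtain ⟨c, τ, hτ⟩ := h T
    have h2 : φ T * τ (rankOne ℂ w w) = 0 := by
      rw [hτ, smul_mul_assoc, ← map_mul, hTC]; simp
    have h3 : τ (rankOne ℂ w w) ≠ 0 := by
      rw [Ne, map_eq_zero_iff _ τ.injective]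
      exact rankOne_ne_zero hw hw
    obtain ⟨v, hv⟩ : ∃ v, τ (rankOne ℂ w w) v ≠ 0 := by
      by_contra! hcon
      exact h3 (ContinuousLinearMap.ext hcon)
    have h4 : φ T (τ (rankOne ℂ w w) v) = 0 := congrArg (fun T : H →L[ℂ] H => T v) h2
    obtain ⟨w', hw'⟩ := hSsurj (τ (rankOne ℂ w w) v)
    rw [← hw'] at h4 hv
    rw [hT, map_sub, sub_apply, ES, sub_eq_zero] at h4
    have hne : inner ℂ y w' ≠ 0 := by
      intro h5
      rw [h5, zero_smul] at h4
      exact hv (hinj _ h4)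
    refine ⟨(inner ℂ y w')⁻¹ • w', ?_, ?_⟩
    · rw [map_smul, map_smul, h4, smul_smul, inv_mul_cancel₀ hne, one_smul]
    · rw [inner_smul_right, inv_mul_cancel₀ hne]
  have hww : inner ℂ w w ≠ 0 := inner_self_ne_zero.2 hw
  obtain ⟨y1, hy1, hy1w⟩ : ∃ y1, inner ℂ y1 w = 1 ∧ ∀ p, inner ℂ y1 p = 0 → inner ℂ w p = 0 := by
    refine ⟨(starRingEnd ℂ) (inner ℂ w w)⁻¹ • w, ?_, fun p hp => ?_⟩
    · rw [inner_smul_left, Complex.conj_conj, inv_mul_cancel₀ hww]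
    · rw [inner_smul_left, Complex.conj_conj] at hp
      exact (mul_eq_zero.1 hp).resolve_left (inv_ne_zero hww)
  obtain ⟨w', hw1, hw2⟩ := key y1 hy1
  have hp1 : inner ℂ y1 (w' - w) = 0 := by rw [inner_sub_right, hw2, hy1, sub_self]
  have hp2 := hy1w _ hp1
  obtain ⟨w'', hw3, hw4⟩ := key (y1 + (w' - w))
    (by rw [inner_add_left, hy1, inner_eq_zero_symm.1 hp2, add_zero])
  have hw5 : w'' = w' := by
    have h6 : S (w'' - w') = 0 := by
      apply hinj
      rw [map_sub S, map_sub (φ A'), hw1, hw3, sub_self]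
    have h7 := hanti.injective (h6.trans (map_zero S).symm)
    exact sub_eq_zero.1 h7
  have hp3 : inner ℂ (w' - w) (w' - w) = (0 : ℂ) := by
    rw [hw5, inner_add_left, hw2] at hw4
    have h8 : inner ℂ (w' - w) w' = (0 : ℂ) 
        := add_eq_left.1 hw4
    rw [inner_sub_right, h8, inner_eq_zero_symm.1 hp2, sub_self]
  have hw6 : w' = w := sub_eq_zero.1 (inner_self_eq_zero.1 hp3)
  rw [hw6, hφA', hA'] at hw1
  simpa using hw1

end LocalAut

/-- If `Φ : B(H) → B(H)` is a bounded linear map such that each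
`Φ(A)` is a scalar multiple of an automorphism applied to `A`, then `Φ` is globally a
scalar multiple of an automorphism of `B(H)`. -/
theorem local_scalar_multiple_of_aut
    {H : Type*} [NormedAddCommGroup H] [InnerProductSpace ℂ H] [CompleteSpace H]
    [TopologicalSpace.SeparableSpace H] (hH : ¬ FiniteDimensional ℂ H)
    (Φ : (H →L[ℂ] H) →L[ℂ] (H →L[ℂ] H))
    (hΦ : ∀ A : H →L[ℂ] H, ∃ (lamA : ℂ) (τA : (H →L[ℂ] H) → (H →L[ℂ] H)),
      IsAlgebraAutomorphism τA ∧ Φ A = lamA • τA A) :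
    ∃ (lam : ℂ) (τ : (H →L[ℂ] H) → (H →L[ℂ] H)),
      IsAlgebraAutomorphism τ ∧ ∀ A : H →L[ℂ] H, Φ A = lam • τ A := by
  have hnt : Nontrivial H := by
    by_contra hcon
    rw [not_nontrivial_iff_subsingleton] at hcon
    exact hH inferInstance
  have hloc : LocAut Φ := by
    intro A
    obtain ⟨c, τ, hτ, hA⟩ := hΦ A
    obtain ⟨e, he⟩ := autEquiv hτ
    exact ⟨c, e, by rw [hA, he]⟩
  obtain ⟨c, e, hc⟩ := hloc 1
  rw [map_one e] at hc
  by_cases hc0 : c = 0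
  · rw [hc0, zero_smul] at hc
    refine ⟨0, id, ⟨⟨fun _ _ => rfl, fun _ _ => rfl⟩, fun _ _ => rfl, Function.bijective_id⟩,
      fun A => ?_⟩
    rw [hloc.eq_zero hc, zero_smul]
  · set Ψ := c⁻¹ • Φ with hΨ
    have hloc' : LocAut (Ψ : (H →L[ℂ] H) →ₗ[ℂ] (H →L[ℂ] H)) := by
      intro A
      obtain ⟨d, e, hA⟩ := hloc A
      refine ⟨c⁻¹ * d, e, ?_⟩
      change c⁻¹ • Φ A = _
      rw [hA, smul_smul]
    have hone : (Ψ : (H →L[ℂ] H) →ₗ[ℂ] (H →L[ℂ] H)) 1 = 1 := by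
      change c⁻¹ • Φ 1 = _
      rw [hc, smul_smul, inv_mul_cancel₀ hc0, one_smul]
    obtain ⟨S, hS⟩ := hloc'.inner_of_unital hH Ψ.continuous hone
    refine ⟨c, S.conjContinuousAlgEquiv, ⟨⟨map_add _, map_smul _⟩, map_mul _,
      S.conjContinuousAlgEquiv.bijective⟩, fun A => ?_⟩
    ext x
    have h2 : (c⁻¹ • Φ A) (S (S.symm x)) = S (A (S.symm x)) := hS A (S.symm x)
    rw [S.apply_symm_apply] at h2
    have h3 : (S.conjContinuousAlgEquiv A) x = S (A (S.symm x)) := rfl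
    rw [smul_apply, h3, ← h2, smul_apply, smul_smul, mul_inv_cancel₀ hc0, one_smul]
end

section
/- Let Φ : B(H) → B(H) be a bounded linear map with the property that for every A ∈ B(H) there exist a number λ_A ∈ ℂ and a surjective linear isometry τ_A of B(H) such that Φ(A) = λ_A · τ_A(A). Then there exist a number λ ∈ ℂ and a surjective linear isometry τ of B(H) such that Φ(A) = λ·τ(A) for every A ∈ B(H). -/
open scoped ZeroAtInfty

/-- A surjective linear isometry of a normed space onto itself. -/
def IsSurjectiveLinearIsometry {A : Type*} [SeminormedAddCommGroup A] [Module ℂ A]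
    (Φ : A → A) : Prop :=
  IsLinearMap ℂ Φ ∧ Function.Surjective Φ ∧ ∀ a : A, ‖Φ a‖ = ‖a‖

namespace LocIso
section Part1
set_option linter.unusedSectionVars false
set_option linter.unusedSimpArgs false
open scoped InnerProductSpace
open ContinuousLinearMap

variable {H : Type*} [NormedAddCommGroup H] [InnerProductSpace ℂ H] [CompleteSpace H]

/-- rank one operator -/
noncomputable abbrev ro (x y : H) : H →L[ℂ] H := InnerProductSpace.rankOne ℂ x y

/-- `B` is orthogonal to the rank one operator `ro x y`. -/
def Kill (B : H →L[ℂ] H) (x y : H) : Prop := B y = 0 ∧ adjoint B x = 0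

/-- contractive perturbation -/
def cp (A X : H →L[ℂ] H) : Prop := ‖A + X‖ ≤ 1 ∧ ‖A - X‖ ≤ 1

/-- second contractive perturbation -/
def cp2 (A B : H →L[ℂ] H) : Prop := ∀ X, cp A X → cp X B

theorem exists_unit_orth (hH : ¬ FiniteDimensional ℂ H) (a b : H) :
    ∃ u : H, ‖u‖ = 1 ∧ ⟪a, u⟫_ℂ = 0 ∧ ⟪b, u⟫_ℂ = 0 := by
  let S : Submodule ℂ H := Submodule.span ℂ {a, b}
  have hfd : FiniteDimensional ℂ S := FiniteDimensional.span_of_finite ℂ (by simp)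
  have hne : Sᗮ ≠ ⊥ := by
    intro h
    rw [Submodule.orthogonal_eq_bot_iff] at h
    apply hH
    rw [h] at hfd
    exact Module.Finite.equiv (Submodule.topEquiv (R := ℂ) (M := H))
  obtain ⟨v, hv, hv0⟩ := Submodule.exists_mem_ne_zero_of_ne_bot hne
  rw [Submodule.mem_orthogonal] at hv
  have hn : ‖v‖ ≠ 0 := norm_ne_zero_iff.2 hv0
  refine ⟨((‖v‖⁻¹ : ℝ) : ℂ) • v, ?_, ?_, ?_⟩
  · rw [norm_smul]; simp [hn]
  · rw [inner_smul_right, hv a (Submodule.subset_span (by simp)), mul_zero]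
  · rw [inner_smul_right, hv b (Submodule.subset_span (by simp)), mul_zero]

theorem exists_normalize {v : H} (hv : v ≠ 0) : ∃ s : ℂ, s ≠ 0 ∧ ‖s • v‖ = 1 := by
  have hn : ‖v‖ ≠ 0 := norm_ne_zero_iff.2 hv
  refine ⟨((‖v‖⁻¹ : ℝ) : ℂ), by simpa using hv, ?_⟩
  rw [norm_smul]; simp [hn]

theorem exists_small (X : H →L[ℂ] H) {ε : ℝ} (hε : 0 < ε) : ∃ t : ℂ, t ≠ 0 ∧ ‖t • X‖ ≤ ε := by
  have htp : 0 < ε / (‖X‖ + 1) := by positivity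
  refine ⟨((ε / (‖X‖ + 1) : ℝ) : ℂ), by exact_mod_cast htp.ne', ?_⟩
  rw [norm_smul, Complex.norm_real, Real.norm_of_nonneg htp.le, div_mul_eq_mul_div,
      div_le_iff₀ (by positivity)]
  nlinarith [norm_nonneg X]

theorem cp_sq {A X : H →L[ℂ] H} (h : cp A X) (z : H) :
    ‖A z‖ ^ 2 + ‖X z‖ ^ 2 ≤ ‖z‖ ^ 2 := by
  have h1 := (A + X).le_of_opNorm_le h.1 z
  have h2 := (A - X).le_of_opNorm_le h.2 z
  have h3 := parallelogram_law_with_norm ℂ (A z) (X z)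
  simp only [add_apply, sub_apply, one_mul] at h1 h2
  nlinarith [norm_nonneg (A z + X z), norm_nonneg (A z - X z), norm_nonneg z]

theorem cp_adj {A X : H →L[ℂ] H} (h : cp A X) : cp (adjoint A) (adjoint X) := by
  constructor
  · rw [← map_add, LinearIsometryEquiv.norm_map]; exact h.1
  · rw [← map_sub, LinearIsometryEquiv.norm_map]; exact h.2

theorem kill_of_cp {x y : H} (hx : ‖x‖ = 1) (hy : ‖y‖ = 1) {X : H →L[ℂ] H}
    (h : cp (ro x y) X) : Kill X x y := by
  constructor
  · have := cp_sq h y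
    simp [inner_self_eq_norm_sq_to_K, hx, hy] at this
    simpa using this
  · have := cp_sq (cp_adj h) x
    simp [inner_self_eq_norm_sq_to_K, hx, hy] at this
    simpa using this

theorem norm_of_kill {x y : H} (hx : ‖x‖ = 1) (hy : ‖y‖ = 1) {X : H →L[ℂ] H}
    (h : Kill X x y) (hX : ‖X‖ ≤ 1) : ‖ro x y + X‖ ≤ 1 := by
  refine opNorm_le_bound _ zero_le_one fun z => ?_
  have hyy : ⟪y, y⟫_ℂ = 1 := by simp [inner_self_eq_norm_sq_to_K, hy]
  set w := z - ⟪y, z⟫_ℂ • y with hw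
  have hyw : ⟪y, w⟫_ℂ = 0 := by
    rw [hw, inner_sub_right, inner_smul_right, hyy]; ring
  have hz : z = ⟪y, z⟫_ℂ • y + w := by rw [hw]; abel
  have hXw : X z = X w := by
    conv_lhs => rw [hz]
    simp [h.1]
  have hort : ⟪x, X w⟫_ℂ = 0 := by
    rw [← adjoint_inner_left, h.2, inner_zero_left]
  have e1 : ‖(ro x y + X) z‖ ^ 2 = ‖⟪y, z⟫_ℂ‖ ^ 2 + ‖X w‖ ^ 2 := by
    have := norm_add_sq_eq_norm_sq_add_norm_sq_of_inner_eq_zero (𝕜 := ℂ) (⟪y, z⟫_ℂ • x) (X w)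
      (by rw [inner_smul_left, hort, mul_zero])
    simp only [add_apply, InnerProductSpace.rankOne_apply, hXw]
    rw [norm_smul, hx, mul_one] at this
    nlinarith
  have e2 : ‖z‖ ^ 2 = ‖⟪y, z⟫_ℂ‖ ^ 2 + ‖w‖ ^ 2 := by
    have := norm_add_sq_eq_norm_sq_add_norm_sq_of_inner_eq_zero (𝕜 := ℂ) (⟪y, z⟫_ℂ • y) w
      (by rw [inner_smul_left, hyw, mul_zero])
    rw [← hz, norm_smul, hy, mul_one] at this
    nlinarith
  have e3 := X.le_of_opNorm_le hX w
  rw [one_mul] at e3 ⊢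
  refine le_of_sq_le_sq ?_ (norm_nonneg _) 
  nlinarith [norm_nonneg (X w)]

theorem cp_of_kill {x y : H} (hx : ‖x‖ = 1) (hy : ‖y‖ = 1) {X : H →L[ℂ] H}
    (h : Kill X x y) (hX : ‖X‖ ≤ 1) : cp (ro x y) X := by
  refine ⟨norm_of_kill hx hy h hX, ?_⟩
  rw [sub_eq_add_neg]
  refine norm_of_kill hx hy ⟨?_, ?_⟩ (by simpa using hX)
  · simp [h.1]
  · simp [h.2]

theorem cp_comm {A X : H →L[ℂ] H} (h : cp A X) : cp X A := by
  refine ⟨by rw [add_comm]; exact h.1, by rw [norm_sub_rev]; exact h.2⟩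

/-- If `B` kills all vectors orthogonal to `y` and `B†` all orthogonal to `x` then `B ∈ ℂ ro x y`. -/
theorem eq_smul_ro {x y : H} (hx : ‖x‖ = 1) (hy : ‖y‖ = 1) {B : H →L[ℂ] H}
    (h1 : ∀ v, ⟪y, v⟫_ℂ = 0 → B v = 0) (h2 : ∀ u, ⟪x, u⟫_ℂ = 0 → adjoint B u = 0) :
    ∃ β : ℂ, B = β • ro x y := by
  have hyy : ⟪y, y⟫_ℂ = 1 := by simp [inner_self_eq_norm_sq_to_K, hy]
  have hxx : ⟪x, x⟫_ℂ = 1 := by simp [inner_self_eq_norm_sq_to_K, hx]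
  have hB : ∀ z, B z = ⟪y, z⟫_ℂ • B y := by
    intro z
    have := h1 (z - ⟪y, z⟫_ℂ • y) (by rw [inner_sub_right, inner_smul_right, hyy]; ring)
    rw [map_sub, map_smul, sub_eq_zero] at this
    exact this
  have hBy : B y = ⟪x, B y⟫_ℂ • x := by
    have hu : ⟪x, B y - ⟪x, B y⟫_ℂ • x⟫_ℂ = 0 := by
      rw [inner_sub_right, inner_smul_right, hxx]; ring
    have h3 := h2 _ hu
    have h4 : ⟪B y - ⟪x, B y⟫_ℂ • x, B y⟫_ℂ = 0 := by
      rw [← adjoint_inner_left, h3, inner_zero_left]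
    have h5 : ⟪B y - ⟪x, B y⟫_ℂ • x, B y - ⟪x, B y⟫_ℂ • x⟫_ℂ = 0 := by
      rw [inner_sub_right, h4, inner_smul_right, inner_eq_zero_symm.1 hu]; ring
    exact sub_eq_zero.1 (inner_self_eq_zero.1 h5)
  refine ⟨⟪x, B y⟫_ℂ, ?_⟩
  ext z
  rw [smul_apply, InnerProductSpace.rankOne_apply, smul_comm, ← hBy, hB z]

theorem cp2_ro (hH : ¬ FiniteDimensional ℂ H) {x y : H} (hx : ‖x‖ = 1) (hy : ‖y‖ = 1)
    {B : H →L[ℂ] H} (h : cp2 (ro x y) B) : ∃ β : ℂ, B = β • ro x y := by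
  have key : ∀ u v, ‖u‖ = 1 → ‖v‖ = 1 → ⟪x, u⟫_ℂ = 0 → ⟪y, v⟫_ℂ = 0 → Kill B u v := by
    intro u v hu hv hxu hyv
    refine kill_of_cp hu hv (h _ (cp_of_kill hx hy ⟨?_, ?_⟩ ?_))
    · simp [inner_eq_zero_symm.1 hyv]
    · simp [inner_eq_zero_symm.1 hxu]
    · simp [hu, hv]
  have norml : ∀ v : H, v ≠ 0 → ‖((‖v‖⁻¹ : ℝ) : ℂ) • v‖ = 1 := by
    intro v hv
    have hn : ‖v‖ ≠ 0 := norm_ne_zero_iff.2 hv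
    rw [norm_smul]; simp [hn]
  refine eq_smul_ro hx hy (fun v hv => ?_) (fun u hu => ?_)
  · by_cases hv0 : v = 0
    · simp [hv0]
    obtain ⟨u, hu1, hu2, -⟩ := exists_unit_orth hH x x
    have := (key u _ hu1 (norml v hv0) hu2 (by rw [inner_smul_right, hv, mul_zero])).1
    rw [map_smul, smul_eq_zero] at this
    refine this.resolve_left ?_
    simpa using hv0
  · by_cases hv0 : u = 0
    · simp [hv0]
    obtain ⟨v, hu1, hu2, -⟩ := exists_unit_orth hH y y
    have := (key _ v (norml u hv0) hu1 (by rw [inner_smul_right, hu, mul_zero]) hu2).2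
    rw [map_smul, smul_eq_zero] at this
    refine this.resolve_left ?_
    simpa using hv0

theorem norm_add_sandwich {A X R : H →L[ℂ] H} (h : cp A X) (hA : ‖A‖ ≤ 1) (hR : ‖R‖ ≤ 1 / 3) :
    ‖X + A * R * A‖ ≤ 1 := by
  refine opNorm_le_bound _ zero_le_one fun z => ?_
  rw [one_mul]
  have e1 := cp_sq h z
  have e2 := cp_sq (cp_adj h) (X z)
  -- ‖X z‖^2 ≤ ‖X† X z‖ * ‖z‖
  have e3 : ‖X z‖ ^ 2 ≤ ‖adjoint X (X z)‖ * ‖z‖ := by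
    have : ⟪X z, X z⟫_ℂ = ⟪adjoint X (X z), z⟫_ℂ := by rw [adjoint_inner_left]
    have h2 := norm_inner_le_norm (𝕜 := ℂ) (adjoint X (X z)) z
    rw [← this, inner_self_eq_norm_sq_to_K] at h2
    simpa using h2
  have e4 : ‖⟪X z, (A * R * A) z⟫_ℂ‖ ≤ ‖adjoint A (X z)‖ * (1 / 3 * ‖A z‖) := by
    have : ⟪X z, (A * R * A) z⟫_ℂ = ⟪adjoint A (X z), R (A z)⟫_ℂ := by
      rw [adjoint_inner_left]; rfl
    rw [this]
    refine (norm_inner_le_norm _ _).trans ?_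
    gcongr
    exact R.le_of_opNorm_le hR _
  have e5 : ‖(A * R * A) z‖ ≤ 1 / 3 * ‖A z‖ := by
    have h1 : ‖A (R (A z))‖ ≤ 1 * ‖R (A z)‖ := A.le_of_opNorm_le hA _
    have h2 := R.le_of_opNorm_le hR (A z)
    rw [one_mul] at h1
    exact h1.trans h2
  have e6 := norm_add_sq (𝕜 := ℂ) (X z) ((A * R * A) z)
  have e7 : RCLike.re ⟪X z, (A * R * A) z⟫_ℂ ≤ ‖adjoint A (X z)‖ * (1 / 3 * ‖A z‖) :=
    (RCLike.re_le_norm _).trans e4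
  have e0 : (X + A * R * A) z = X z + (A * R * A) z := rfl
  rw [e0]
  refine le_of_sq_le_sq ?_ (norm_nonneg _)
  rw [e6]
  generalize RCLike.re ⟪X z, (A * R * A) z⟫_ℂ = r at *
  generalize hp : ‖adjoint A (X z)‖ = p at *
  generalize hq : ‖adjoint X (X z)‖ = q at *
  generalize ‖X z‖ = s at *
  have hn : 0 ≤ ‖A z‖ := norm_nonneg _
  generalize ‖A z‖ = a at *
  have hm : 0 ≤ ‖(A * R * A) z‖ := norm_nonneg _
  generalize ‖(A * R * A) z‖ = m at *
  have hz : 0 ≤ ‖z‖ := norm_nonneg _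
  generalize ‖z‖ = n at *
  have hp0 : 0 ≤ p := by rw [← hp]; exact norm_nonneg _
  have hq0 : 0 ≤ q := by rw [← hq]; exact norm_nonneg _
  -- p^2 ≤ s^2 - q^2,  q n ≥ s^2, a^2 ≤ n^2 - s^2;  p ^2 n^2 ≤ s^2 (n^2 - s^2)
  have hpn : p ^ 2 * n ^ 2 ≤ s ^ 2 * (n ^ 2 - s ^ 2) := by
    have : (s ^ 2) ^ 2 ≤ (q * n) ^ 2 := by gcongr
    nlinarith [mul_nonneg hz hz]
  have hpa : p * a ≤ n ^ 2 - s ^ 2 := by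
    by_cases hn0 : n = 0
    · subst hn0
      have : a = 0 := by nlinarith [sq_nonneg s]
      subst this
      have : s = 0 := by nlinarith
      subst this
      simp
    have hnp : 0 < n := lt_of_le_of_ne hz (Ne.symm hn0)
    have h0 : 0 ≤ n ^ 2 - s ^ 2 := by nlinarith
    refine le_of_sq_le_sq ?_ h0
    have h1 : p ^ 2 * n ^ 2 ≤ n ^ 2 * (n ^ 2 - s ^ 2) := by nlinarith
    have h2 : p ^ 2 ≤ n ^ 2 - s ^ 2 := by
      have := sq_pos_of_pos hnp
      nlinarith
    calc (p * a) ^ 2 = p ^ 2 * a ^ 2 := by ring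
      _ ≤ (n ^ 2 - s ^ 2) * (n ^ 2 - s ^ 2) := by
        gcongr
        linarith
      _ = _ := by ring
  have hma : m ^ 2 ≤ 1 / 9 * a ^ 2 := by nlinarith
  nlinarith

theorem cp2_sandwich {A R : H →L[ℂ] H} (hA : ‖A‖ ≤ 1) (hR : ‖R‖ ≤ 1 / 3) :
    cp2 A (A * R * A) := by
  intro X hX
  refine ⟨norm_add_sandwich hX hA hR, ?_⟩
  have := norm_add_sandwich hX hA (R := -R) (by simpa using hR)
  simpa [sub_eq_add_neg] using this

theorem exists_ro_of_cp2 {A : H →L[ℂ] H} (hA : ‖A‖ = 1)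
    (h : ∀ B, cp2 A B → ∃ β : ℂ, B = β • A) : ∃ x y : H, ‖x‖ = 1 ∧ ‖y‖ = 1 ∧ A = ro x y := by
  have hA0 : A ≠ 0 := by rintro rfl; simp at hA
  obtain ⟨z, hz⟩ : ∃ z, A z ≠ 0 := by
    by_contra! hc
    exact hA0 (ContinuousLinearMap.ext hc)
  -- R = t • ro (z) (A z)
  set R0 := ro z (A z) with hR0
  obtain ⟨t, ht0, hR⟩ := exists_small R0 (ε := 1 / 3) (by norm_num)
  obtain ⟨β, hβ⟩ := h _ (cp2_sandwich hA.le hR)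
  have happ : ∀ w, β • A w = (t * ⟪A z, A w⟫_ℂ) • A z := by
    intro w
    have := congrArg (fun T : H →L[ℂ] H => T w) hβ
    simp only [smul_apply] at this
    rw [← this]
    simp [hR0, smul_smul]
  have hβ0 : β ≠ 0 := by
    rintro rfl
    have := happ z
    rw [zero_smul, eq_comm, smul_eq_zero] at this
    simp [ht0, hz] at this
  have hAw : A = ro (A z) (adjoint A ((starRingEnd ℂ (β⁻¹ * t)) • A z)) := by
    ext w
    rw [InnerProductSpace.rankOne_apply, adjoint_inner_left, inner_smul_left]
    have := happ w
    have h2 : A w = β⁻¹ • (β • A w) := by rw [smul_smul, inv_mul_cancel₀ hβ0, one_smul]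
    conv_lhs => rw [h2, this, smul_smul, ← mul_assoc]
    simp
  generalize A z = x at *
  generalize adjoint A ((starRingEnd ℂ (β⁻¹ * t)) • x) = y at *
  obtain ⟨s, hs0, hs⟩ := exists_normalize hz
  have hA2 : A = ro (s • x) ((starRingEnd ℂ s⁻¹) • y) := by
    rw [hAw]
    ext w
    simp [inner_smul_left, smul_smul]
    congr 1
    field_simp
  refine ⟨_, _, hs, ?_, hA2⟩
  rw [hA2, InnerProductSpace.norm_rankOne, hs, one_mul] at hA
  exact hA

abbrev Iso (H : Type*) [NormedAddCommGroup H] [InnerProductSpace ℂ H] [CompleteSpace H] :=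
  (H →L[ℂ] H) ≃ₗᵢ[ℂ] (H →L[ℂ] H)

theorem iso_cp (τ : Iso H) {A X : H →L[ℂ] H} : cp (τ A) (τ X) ↔ cp A X := by
  unfold cp
  rw [← map_add, ← map_sub, τ.norm_map, τ.norm_map]

theorem iso_cp2 (τ : Iso H) {A X : H →L[ℂ] H} (h : cp2 (τ A) X) : cp2 A (τ.symm X) := by
  intro Y hY
  have := h (τ Y) ((iso_cp τ).2 hY)
  rw [← iso_cp τ, τ.apply_symm_apply]
  exact this

theorem iso_ro (hH : ¬ FiniteDimensional ℂ H) (τ : Iso H) {x y : H} (hx : ‖x‖ = 1)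
    (hy : ‖y‖ = 1) : ∃ x' y' : H, ‖x'‖ = 1 ∧ ‖y'‖ = 1 ∧ τ (ro x y) = ro x' y' := by
  apply exists_ro_of_cp2
  · rw [τ.norm_map]; simp [hx, hy]
  · intro B hB
    obtain ⟨β, hβ⟩ := cp2_ro hH hx hy (iso_cp2 τ hB)
    refine ⟨β, ?_⟩
    rw [← map_smul, ← hβ, τ.apply_symm_apply]

theorem iso_kill (τ : Iso H) {x y x' y' : H} (hx : ‖x‖ = 1) (hy : ‖y‖ = 1) (hx' : ‖x'‖ = 1)
    (hy' : ‖y'‖ = 1) (h : τ (ro x y) = ro x' y') {X : H →L[ℂ] H} (hX : Kill X x y) :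
    Kill (τ X) x' y' := by
  obtain ⟨t, ht0, hn⟩ := exists_small X one_pos
  have hc : cp (ro x y) (t • X) := by
    refine cp_of_kill hx hy ⟨?_, ?_⟩ hn
    · simp [hX.1]
    · rw [map_smulₛₗ, smul_apply, hX.2, smul_zero]
  rw [← iso_cp τ, h] at hc
  have := kill_of_cp hx' hy' hc
  rw [map_smul] at this
  refine ⟨?_, ?_⟩
  · simpa [ht0] using this.1
  · have h2 := this.2
    rw [map_smulₛₗ, smul_apply, smul_eq_zero] at h2
    exact h2.resolve_left (by simpa using ht0)

theorem iso_one_inj (hH : ¬ FiniteDimensional ℂ H) (τ : Iso H) {y : H} (h : τ 1 y = 0) :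
    y = 0 := by
  by_contra hy0
  have hn : ‖y‖ ≠ 0 := norm_ne_zero_iff.2 hy0
  obtain ⟨y1, hy1, hk⟩ : ∃ y1 : H, ‖y1‖ = 1 ∧ τ 1 y1 = 0 := by
    refine ⟨((‖y‖⁻¹ : ℝ) : ℂ) • y, ?_, ?_⟩
    · rw [norm_smul]; simp [hn]
    · rw [map_smul, h, smul_zero]
  obtain ⟨p, q, hp, hq, hpq⟩ := iso_ro hH τ.symm hy1 hy1
  obtain ⟨c, hc, hcs⟩ := RCLike.exists_norm_eq_mul_self ⟪q, p⟫_ℂ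
  have hup : ‖(1 : H →L[ℂ] H) + c • ro p q‖ ^ 2 ≤ 2 := by
    rw [← hpq, ← map_smul, ← τ.norm_map, map_add, τ.apply_symm_apply]
    have h1 : ‖τ 1‖ ≤ 1 := by rw [τ.norm_map]; exact norm_id_le
    have hb : ‖τ 1 + c • ro y1 y1‖ ≤ Real.sqrt 2 := by
      refine opNorm_le_bound _ (Real.sqrt_nonneg _) fun z => ?_
      set w := z - ⟪y1, z⟫_ℂ • y1 with hw
      have hyy : ⟪y1, y1⟫_ℂ = 1 := by simp [inner_self_eq_norm_sq_to_K, hy1]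
      have hyw : ⟪y1, w⟫_ℂ = 0 := by
        rw [hw, inner_sub_right, inner_smul_right, hyy]; ring
      have hz : z = ⟪y1, z⟫_ℂ • y1 + w := by rw [hw]; abel
      have hXw : τ 1 z = τ 1 w := by
        conv_lhs => rw [hz]
        simp [hk]
      have e2 : ‖z‖ ^ 2 = ‖⟪y1, z⟫_ℂ‖ ^ 2 + ‖w‖ ^ 2 := by
        have := norm_add_sq_eq_norm_sq_add_norm_sq_of_inner_eq_zero (𝕜 := ℂ) (⟪y1, z⟫_ℂ • y1) w
          (by rw [inner_smul_left, hyw, mul_zero])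
        rw [← hz, norm_smul, hy1, mul_one] at this
        nlinarith
      have e3 := (τ 1).le_of_opNorm_le h1 w
      rw [one_mul] at e3
      have e4 : ‖(τ 1 + c • ro y1 y1) z‖ ≤ ‖w‖ + ‖⟪y1, z⟫_ℂ‖ := by
        have : (τ 1 + c • ro y1 y1) z = τ 1 w + c • (⟪y1, z⟫_ℂ • y1) := by
          rw [← hXw]; rfl
        rw [this]
        refine (norm_add_le _ _).trans ?_
        rw [norm_smul, norm_smul, hc, hy1]
        linarith
      refine e4.trans ?_
      refine le_of_sq_le_sq ?_ (by positivity)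
      rw [mul_pow, Real.sq_sqrt (by norm_num), e2]
      nlinarith [sq_nonneg (‖w‖ - ‖⟪y1, z⟫_ℂ‖)]
    calc _ ≤ (Real.sqrt 2) ^ 2 := by gcongr
      _ = 2 := Real.sq_sqrt (by norm_num)
  -- lower bound
  have hlow : (5 : ℝ) / 2 ≤ ‖(1 : H →L[ℂ] H) + c • ro p q‖ ^ 2 := by
    set p' := c • p with hp'
    have hp1 : ‖p'‖ = 1 := by rw [hp', norm_smul, hc, hp, one_mul]
    have hro : c • ro p q = ro p' q := by
      ext z; simp [hp', smul_smul, mul_comm]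
    rw [hro]
    have hs : ⟪q, p'⟫_ℂ = ((‖⟪q, p⟫_ℂ‖ : ℝ) : ℂ) := by
      rw [hp', inner_smul_right]; exact hcs.symm
    have hs' : ⟪p', q⟫_ℂ = ((‖⟪q, p⟫_ℂ‖ : ℝ) : ℂ) := by
      rw [← inner_conj_symm, hs, Complex.conj_ofReal]
    have hs0 : 0 ≤ ‖⟪q, p⟫_ℂ‖ := norm_nonneg _
    generalize ‖⟪q, p⟫_ℂ‖ = σ at hs hs' hs0
    have hqq : ⟪q, q⟫_ℂ = 1 := by simp [inner_self_eq_norm_sq_to_K, hq]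
    have hb := ((1 : H →L[ℂ] H) + ro p' q).le_opNorm (q + p')
    generalize ‖(1 : H →L[ℂ] H) + ro p' q‖ = N at hb
    have h1 : ((1 : H →L[ℂ] H) + ro p' q) (q + p') = q + ((2 + σ : ℝ) : ℂ) • p' := by
      change (q + p') + ⟪q, q + p'⟫_ℂ • p' = _
      rw [inner_add_right, hqq, hs]
      push_cast
      module
    have n1 : ‖q + p'‖ ^ 2 = 2 + 2 * σ := by
      rw [norm_add_sq (𝕜 := ℂ), hs, hq, hp1]
      simp; ring
    have n2 : ‖q + ((2 + σ : ℝ) : ℂ) • p'‖ ^ 2 = 5 + 8 * σ + 3 * σ ^ 2 := by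
      rw [norm_add_sq (𝕜 := ℂ), inner_smul_right, hs, norm_smul, hq, hp1, ← Complex.ofReal_mul,
        Complex.norm_real, Real.norm_of_nonneg (by positivity)]
      simp; ring
    rw [h1] at hb
    have hb2 : ‖q + ((2 + σ : ℝ) : ℂ) • p'‖ ^ 2 ≤ N ^ 2 * ‖q + p'‖ ^ 2 := by
      rw [← mul_pow]; gcongr
    rw [n1, n2] at hb2
    have h3 : (1 + σ) * (5 + 3 * σ) ≤ (1 + σ) * (2 * N ^ 2) := by nlinarith
    have h4 := le_of_mul_le_mul_left h3 (by positivity)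
    linarith
  linarith

end Part1
end LocIso

namespace LocIso
section Part2
set_option linter.unusedSectionVars false
set_option linter.unusedSimpArgs false
open scoped InnerProductSpace
open ContinuousLinearMap

variable {H : Type*} [NormedAddCommGroup H] [InnerProductSpace ℂ H] [CompleteSpace H]

/-- locally a scalar multiple of a surjective isometry -/
def Loc (Φ : (H →L[ℂ] H) →L[ℂ] (H →L[ℂ] H)) : Prop :=
  ∀ A, ∃ (l : ℂ) (τ : Iso H), Φ A = l • τ A

/-- rank at most one -/
def R1 (G : H →L[ℂ] H) : Prop :=
  ∀ a b c d, ⟪a, G b⟫_ℂ * ⟪c, G d⟫_ℂ = ⟪a, G d⟫_ℂ * ⟪c, G b⟫_ℂ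

theorem r1_ro (x y : H) : R1 (ro x y) := by
  intro a b c d
  simp only [InnerProductSpace.rankOne_apply, inner_smul_right]
  ring

theorem r1_smul {G : H →L[ℂ] H} (h : R1 G) (t : ℂ) : R1 (t • G) := by
  intro a b c d
  simp only [smul_apply, inner_smul_right]
  linear_combination t ^ 2 * h a b c d

theorem inner_self_one {x : H} (hx : ‖x‖ = 1) : ⟪x, x⟫_ℂ = 1 := by
  simp [inner_self_eq_norm_sq_to_K, hx]

theorem pi_cube {a1 b1 a2 b2 : H} (ha1 : ‖a1‖ = 1) (hb1 : ‖b1‖ = 1) (ha2 : ‖a2‖ = 1)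
    (hb2 : ‖b2‖ = 1) (ha : ⟪a1, a2⟫_ℂ = 0) (hb : ⟪b1, b2⟫_ℂ = 0) {ζ : ℂ}
    (hζ : ζ = 1 ∨ ζ = -1) (z : H) :
    (ro a1 b1 + ζ • ro a2 b2) (adjoint (ro a1 b1 + ζ • ro a2 b2) ((ro a1 b1 + ζ • ro a2 b2) z))
      = (ro a1 b1 + ζ • ro a2 b2) z := by
  have ha' := inner_eq_zero_symm.1 ha
  have hb' := inner_eq_zero_symm.1 hb
  rw [map_add, map_smulₛₗ, InnerProductSpace.adjoint_rankOne, InnerProductSpace.adjoint_rankOne]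
  simp only [add_apply, smul_apply, InnerProductSpace.rankOne_apply, inner_add_right,
    inner_smul_right, ha, ha', hb, hb', inner_self_one ha1, inner_self_one ha2,
    inner_self_one hb1, inner_self_one hb2]
  rcases hζ with rfl | rfl
  · simp
  · simp

theorem pi_not_r1 {a1 b1 a2 b2 : H} (ha1 : ‖a1‖ = 1) (hb1 : ‖b1‖ = 1) (ha2 : ‖a2‖ = 1)
    (hb2 : ‖b2‖ = 1) (ha : ⟪a1, a2⟫_ℂ = 0) (hb : ⟪b1, b2⟫_ℂ = 0) {ζ l : ℂ}
    (hζ : ζ = 1 ∨ ζ = -1) (h : R1 (l • (ro a1 b1 + ζ • ro a2 b2))) : l = 0 := by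
  have ha' := inner_eq_zero_symm.1 ha
  have hb' := inner_eq_zero_symm.1 hb
  have := h a1 b1 a2 b2
  simp only [add_apply, smul_apply, InnerProductSpace.rankOne_apply, inner_add_right,
    inner_smul_right, ha, ha', hb, hb', inner_self_one ha1, inner_self_one ha2,
    inner_self_one hb1, inner_self_one hb2] at this
  rcases hζ with rfl | rfl
  · simpa using this
  · simpa using this

theorem pair_core {p1 q1 p2 q2 : H} (hq1 : ‖q1‖ = 1) (hq2 : ‖q2‖ = 1)
    (hc : ∀ ζ : ℂ, ζ = 1 ∨ ζ = -1 → ∃ μ : ℂ, ∀ z,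
      (ro p1 q1 + ζ • ro p2 q2) (adjoint (ro p1 q1 + ζ • ro p2 q2)
        ((ro p1 q1 + ζ • ro p2 q2) z)) = μ • (ro p1 q1 + ζ • ro p2 q2) z)
    (hr : ∀ ζ : ℂ, ζ = 1 ∨ ζ = -1 → R1 (ro p1 q1 + ζ • ro p2 q2) →
      ro p1 q1 + ζ • ro p2 q2 = 0) :
    (p1 = 0 ∧ p2 = 0) ∨ (‖p1‖ = ‖p2‖ ∧ ⟪p1, p2⟫_ℂ = 0 ∧ ⟪q1, q2⟫_ℂ = 0) := by
  have hq11 := inner_self_one hq1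
  have hq22 := inner_self_one hq2
  have hq10 : q1 ≠ 0 := by rintro rfl; simp at hq1
  have hq20 : q2 ≠ 0 := by rintro rfl; simp at hq2
  -- if both perturbations are of rank one, everything vanishes
  have triv : (∀ ζ : ℂ, ζ = 1 ∨ ζ = -1 → R1 (ro p1 q1 + ζ • ro p2 q2)) → (p1 = 0 ∧ p2 = 0) := by
    intro h
    have h1 := hr 1 (Or.inl rfl) (h 1 (Or.inl rfl))
    have h2 := hr (-1) (Or.inr rfl) (h (-1) (Or.inr rfl))
    have h3 : ro p1 q1 = 0 := by
      have : (2 : ℂ) • ro p1 q1 = 0 := by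
        have e : (2 : ℂ) • ro p1 q1 = (ro p1 q1 + (1 : ℂ) • ro p2 q2)
          + (ro p1 q1 + (-1 : ℂ) • ro p2 q2) := by module
        rw [e, h1, h2, add_zero]
      exact (smul_eq_zero.1 this).resolve_left (by norm_num)
    have h4 : ro p2 q2 = 0 := by
      rw [h3, zero_add, one_smul] at h1; exact h1
    exact ⟨(InnerProductSpace.rankOne_eq_zero.1 h3).resolve_right hq10,
      (InnerProductSpace.rankOne_eq_zero.1 h4).resolve_right hq20⟩
  by_cases hb : q2 - ⟪q1, q2⟫_ℂ • q1 = 0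
  · left
    apply triv
    intro ζ _
    rw [sub_eq_zero] at hb
    have : ro p1 q1 + ζ • ro p2 q2
        = ro (p1 + (ζ * starRingEnd ℂ ⟪q1, q2⟫_ℂ) • p2) q1 := by
      ext z
      rw [hb]
      simp only [add_apply, smul_apply, InnerProductSpace.rankOne_apply, inner_smul_left,
        inner_smul_right, hq11]
      rw [mul_one]
      module
    rw [this]
    exact r1_ro _ _
  by_cases ha : ⟪p2, p2⟫_ℂ • p1 - ⟪p2, p1⟫_ℂ • p2 = 0
  · left
    apply triv
    intro ζ _
    by_cases hp2 : p2 = 0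
    · have hz : ro (0 : H) q2 = 0 := by ext; simp
      rw [hp2, hz, smul_zero, add_zero]; exact r1_ro p1 q1
    have hp22 : ⟪p2, p2⟫_ℂ ≠ 0 := inner_self_ne_zero.2 hp2
    rw [sub_eq_zero] at ha
    have hp1 : p1 = ((⟪p2, p2⟫_ℂ)⁻¹ * ⟪p2, p1⟫_ℂ) • p2 := by
      rw [mul_smul, ← ha, smul_smul, inv_mul_cancel₀ hp22, one_smul]
    generalize (⟪p2, p2⟫_ℂ)⁻¹ * ⟪p2, p1⟫_ℂ = κ at hp1
    have : ro p1 q1 + ζ • ro p2 q2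
        = ro p2 (starRingEnd ℂ κ • q1 + starRingEnd ℂ ζ • q2) := by
      ext z
      rw [hp1]
      simp only [add_apply, smul_apply, InnerProductSpace.rankOne_apply, inner_smul_left,
        inner_add_left, Complex.conj_conj]
      module
    rw [this]
    exact r1_ro _ _
  right
  set b := q2 - ⟪q1, q2⟫_ℂ • q1 with hbdef
  set a := ⟪p2, p2⟫_ℂ • p1 - ⟪p2, p1⟫_ℂ • p2 with hadef
  have hq1b : ⟪q1, b⟫_ℂ = 0 := by
    rw [hbdef, inner_sub_right, inner_smul_right, hq11]; ring
  have hq2b : ⟪q2, b⟫_ℂ ≠ 0 := by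
    have : ⟪q2, b⟫_ℂ = ⟪b, b⟫_ℂ := by
      conv_rhs => rw [hbdef, inner_sub_left, inner_smul_left, hq1b, mul_zero, sub_zero]
    rw [this]; exact inner_self_ne_zero.2 hb
  have hp2a : ⟪p2, a⟫_ℂ = 0 := by
    rw [hadef, inner_sub_right, inner_smul_right, inner_smul_right]; ring
  have hap2 := inner_eq_zero_symm.1 hp2a
  have hap1 : ⟪a, p1⟫_ℂ ≠ 0 := by
    have : ⟪a, a⟫_ℂ = ⟪p2, p2⟫_ℂ * ⟪a, p1⟫_ℂ := by
      conv_lhs => rw [hadef, inner_sub_right, ← hadef, inner_smul_right, inner_smul_right, hap2]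
      ring
    intro h0
    rw [h0, mul_zero] at this
    exact ha (inner_self_eq_zero.1 this)
  have hp20 : p2 ≠ 0 := by
    rintro h0; apply ha; rw [hadef, h0]; simp
  have hp10 : p1 ≠ 0 := by
    rintro h0; apply ha; rw [hadef, h0]; simp
  have hp22 : ⟪p2, p2⟫_ℂ ≠ 0 := inner_self_ne_zero.2 hp20
  have key : ∀ ζ : ℂ, ζ = 1 ∨ ζ = -1 → ⟪p1, p2⟫_ℂ + ζ * (⟪p2, p2⟫_ℂ * ⟪q1, q2⟫_ℂ) = 0 := by
    intro ζ hζ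
    obtain ⟨μ, hμ⟩ := hc ζ hζ
    have h1 := congrArg (fun v => ⟪a, v⟫_ℂ) (hμ b)
    rw [map_add, map_smulₛₗ, InnerProductSpace.adjoint_rankOne,
      InnerProductSpace.adjoint_rankOne] at h1
    simp only [add_apply, smul_apply, InnerProductSpace.rankOne_apply, inner_add_right,
      inner_smul_right, hq1b, hap2, hq11, hq22] at h1
    have hζ2 : ζ * ζ = 1 := by rcases hζ with rfl | rfl <;> norm_num
    have hζc : starRingEnd ℂ ζ = ζ := by rcases hζ with rfl | rfl <;> simp
    have hζ0 : ζ ≠ 0 := by rcases hζ with rfl | rfl <;> norm_num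
    rw [hζc] at h1
    have h2 : ζ * ⟪q2, b⟫_ℂ * ⟪a, p1⟫_ℂ *
        (⟪p1, p2⟫_ℂ + ζ * (⟪p2, p2⟫_ℂ * ⟪q1, q2⟫_ℂ)) = 0 := by
      linear_combination h1
    simpa [hζ0, hq2b, hap1] using h2
  have k1 := key 1 (Or.inl rfl)
  have k2 := key (-1) (Or.inr rfl)
  have hp12 : ⟪p1, p2⟫_ℂ = 0 := by linear_combination (k1 + k2) / 2
  have hq12 : ⟪q1, q2⟫_ℂ = 0 := by
    have : ⟪p2, p2⟫_ℂ * ⟪q1, q2⟫_ℂ = 0 := by linear_combination (k1 - k2) / 2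
    exact (mul_eq_zero.1 this).resolve_left hp22
  refine ⟨?_, hp12, hq12⟩
  have hp21 := inner_eq_zero_symm.1 hp12
  have hq21 := inner_eq_zero_symm.1 hq12
  obtain ⟨μ, hμ⟩ := hc 1 (Or.inl rfl)
  have e1 := hμ q1
  have e2 := hμ q2
  rw [map_add, map_smulₛₗ, InnerProductSpace.adjoint_rankOne,
      InnerProductSpace.adjoint_rankOne] at e1 e2
  simp [add_apply, smul_apply, InnerProductSpace.rankOne_apply, inner_add_right,
      inner_smul_right, hq12, hq21, hp12, hp21, hq1, hq2] at e1 e2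
  have f1 := smul_left_injective ℂ hp10 e1
  have f2 := smul_left_injective ℂ hp20 e2
  have f3 : (‖p1‖ : ℂ) ^ 2 = (‖p2‖ : ℂ) ^ 2 := by rw [f1, f2]
  have f4 : ‖p1‖ ^ 2 = ‖p2‖ ^ 2 := by exact_mod_cast f3
  exact (sq_eq_sq₀ (norm_nonneg _) (norm_nonneg _)).1 f4

variable {Φ : (H →L[ℂ] H) →L[ℂ] (H →L[ℂ] H)}

theorem loc_ro (hH : ¬ FiniteDimensional ℂ H) (hΦ : Loc Φ) {x y : H} (hx : ‖x‖ = 1)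
    (hy : ‖y‖ = 1) : ∃ p q : H, ‖q‖ = 1 ∧ Φ (ro x y) = ro p q := by
  obtain ⟨l, τ, h⟩ := hΦ (ro x y)
  obtain ⟨x', y', hx', hy', h'⟩ := iso_ro hH τ hx hy
  refine ⟨l • x', y', hy', ?_⟩
  rw [h, h']
  ext z
  simp only [smul_apply, InnerProductSpace.rankOne_apply]
  exact smul_comm _ _ _

theorem kill_ro {x y a b : H} (ha : ‖a‖ = 1) (hb : ‖b‖ = 1) (hx : ‖x‖ = 1) (hy : ‖y‖ = 1) :
    Kill (ro a b) x y ↔ ⟪x, a⟫_ℂ = 0 ∧ ⟪y, b⟫_ℂ = 0 := by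
  have ha0 : a ≠ 0 := by rintro rfl; simp at ha
  have hb0 : b ≠ 0 := by rintro rfl; simp at hb
  unfold Kill
  rw [InnerProductSpace.adjoint_rankOne]
  simp only [InnerProductSpace.rankOne_apply, smul_eq_zero, ha0, hb0, or_false]
  rw [inner_eq_zero_symm (x := b), inner_eq_zero_symm (x := a), and_comm]

theorem loc_pair (hH : ¬ FiniteDimensional ℂ H) (hΦ : Loc Φ) {x1 y1 x2 y2 : H}
    (hx1 : ‖x1‖ = 1) (hy1 : ‖y1‖ = 1) (hx2 : ‖x2‖ = 1) (hy2 : ‖y2‖ = 1)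
    (hx : ⟪x1, x2⟫_ℂ = 0) (hy : ⟪y1, y2⟫_ℂ = 0) {p1 q1 p2 q2 : H}
    (hq1 : ‖q1‖ = 1) (hq2 : ‖q2‖ = 1)
    (h1 : Φ (ro x1 y1) = ro p1 q1) (h2 : Φ (ro x2 y2) = ro p2 q2) :
    (p1 = 0 ∧ p2 = 0) ∨ (‖p1‖ = ‖p2‖ ∧ ⟪p1, p2⟫_ℂ = 0 ∧ ⟪q1, q2⟫_ℂ = 0) := by
  have hG : ∀ ζ : ℂ, ∃ (l : ℂ) (a1 b1 a2 b2 : H), ‖a1‖ = 1 ∧ ‖b1‖ = 1 ∧ ‖a2‖ = 1 ∧ ‖b2‖ = 1 ∧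
      ⟪a1, a2⟫_ℂ = 0 ∧ ⟪b1, b2⟫_ℂ = 0 ∧
      ro p1 q1 + ζ • ro p2 q2 = l • (ro a1 b1 + ζ • ro a2 b2) := by
    intro ζ
    obtain ⟨l, τ, h⟩ := hΦ (ro x1 y1 + ζ • ro x2 y2)
    obtain ⟨a1, b1, ha1, hb1, e1⟩ := iso_ro hH τ hx1 hy1
    obtain ⟨a2, b2, ha2, hb2, e2⟩ := iso_ro hH τ hx2 hy2
    have hk := iso_kill τ hx1 hy1 ha1 hb1 e1 ((kill_ro hx2 hy2 hx1 hy1).2 ⟨hx, hy⟩)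
    rw [e2, kill_ro ha2 hb2 ha1 hb1] at hk
    refine ⟨l, a1, b1, a2, b2, ha1, hb1, ha2, hb2, hk.1, hk.2, ?_⟩
    rw [map_add, map_smul, h1, h2, map_add, map_smul, e1, e2] at h
    exact h
  refine pair_core hq1 hq2 ?_ ?_
  · intro ζ hζ
    obtain ⟨l, a1, b1, a2, b2, ha1, hb1, ha2, hb2, ha, hb, e⟩ := hG ζ
    rw [e]
    have := pi_cube ha1 hb1 ha2 hb2 ha hb hζ
    generalize ro a1 b1 + ζ • ro a2 b2 = w at *
    refine ⟨l * starRingEnd ℂ l, fun z => ?_⟩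
    rw [map_smulₛₗ]
    simp only [smul_apply, map_smul, this]
    module
  · intro ζ hζ
    obtain ⟨l, a1, b1, a2, b2, ha1, hb1, ha2, hb2, ha, hb, e⟩ := hG ζ
    intro hR
    rw [e] at hR ⊢
    rw [pi_not_r1 ha1 hb1 ha2 hb2 ha hb hζ hR, zero_smul]

theorem loc_const (hH : ¬ FiniteDimensional ℂ H) (hΦ : Loc Φ) {x y x' y' : H}
    (hx : ‖x‖ = 1) (hy : ‖y‖ = 1) (hx' : ‖x'‖ = 1) (hy' : ‖y'‖ = 1) :
    ‖Φ (ro x y)‖ = ‖Φ (ro x' y')‖ := by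
  obtain ⟨u, hu, hu1, hu2⟩ := exists_unit_orth hH x x'
  obtain ⟨v, hv, hv1, hv2⟩ := exists_unit_orth hH y y'
  have aux : ∀ x y : H, ‖x‖ = 1 → ‖y‖ = 1 → ⟪x, u⟫_ℂ = 0 → ⟪y, v⟫_ℂ = 0 →
      ‖Φ (ro x y)‖ = ‖Φ (ro u v)‖ := by
    intro x y hx hy h1 h2
    obtain ⟨p1, q1, hq1, e1⟩ := loc_ro hH hΦ hx hy
    obtain ⟨p2, q2, hq2, e2⟩ := loc_ro hH hΦ hu hv
    rw [e1, e2, InnerProductSpace.norm_rankOne, InnerProductSpace.norm_rankOne, hq1, hq2]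
    rcases loc_pair hH hΦ hx hy hu hv h1 h2 hq1 hq2 e1 e2 with h | h
    · rw [h.1, h.2]
    · rw [h.1]
  rw [aux x y hx hy hu1 hv1, aux x' y' hx' hy' hu2 hv2]

/-- for all unit `ξ` there is a unit `y` with `Φ(1) y = Φ(ξ ⊗ ξ) y`. -/
theorem loc_one_aux (hH : ¬ FiniteDimensional ℂ H) (hΦ : Loc Φ) {ξ : H} (hξ : ‖ξ‖ = 1) :
    ∃ y : H, ‖y‖ = 1 ∧ Φ 1 y = Φ (ro ξ ξ) y := by
  obtain ⟨l, τ, h⟩ := hΦ (1 - ro ξ ξ)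
  obtain ⟨a, b, ha, hb, e⟩ := iso_ro hH τ hξ hξ
  have hk : Kill (1 - ro ξ ξ) ξ ξ := by
    constructor
    · change ξ - ⟪ξ, ξ⟫_ℂ • ξ = 0
      rw [inner_self_one hξ, one_smul, sub_self]
    · rw [map_sub, InnerProductSpace.adjoint_rankOne]
      have : adjoint (1 : H →L[ℂ] H) = 1 := star_one _
      rw [this]
      change ξ - ⟪ξ, ξ⟫_ℂ • ξ = 0
      rw [inner_self_one hξ, one_smul, sub_self]
  have := (iso_kill τ hξ hξ ha hb e hk).1
  refine ⟨b, hb, ?_⟩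
  have h2 := congrArg (fun T : H →L[ℂ] H => T b) h
  simp only [map_sub, sub_apply, smul_apply] at h2
  rw [map_sub, sub_apply] at this
  rw [this, smul_zero] at h2
  exact sub_eq_zero.1 h2

theorem loc_one_zero (hH : ¬ FiniteDimensional ℂ H) (hΦ : Loc Φ)
    (h0 : ∀ x y : H, Φ (ro x y) = 0) : Φ 1 = 0 := by
  obtain ⟨ξ, hξ, -⟩ := exists_unit_orth hH (0 : H) 0
  obtain ⟨y, hy, e⟩ := loc_one_aux hH hΦ hξ
  obtain ⟨l, τ, h⟩ := hΦ 1
  rw [h0, h] at e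
  have e' : l • (τ 1 y) = 0 := e
  rcases smul_eq_zero.1 e' with hl | hl
  · rw [h, hl, zero_smul]
  · have := iso_one_inj hH τ hl
    simp [this] at hy

theorem loc_one_id (hH : ¬ FiniteDimensional ℂ H) (hΦ : Loc Φ)
    (h0 : ∀ x y : H, Φ (ro x y) = ro x y) : Φ 1 = 1 := by
  obtain ⟨ξ, hξ, -⟩ := exists_unit_orth hH (0 : H) 0
  have hne : Φ 1 ≠ 0 := by
    intro hB
    obtain ⟨l, τ, h⟩ := hΦ (1 + ro ξ ξ)
    rw [map_add, hB, zero_add, h0] at h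
    obtain ⟨p, q, hp, hq, e⟩ := iso_ro hH τ.symm hξ hξ
    have e2 : ro p q = l • (1 + ro ξ ξ) := by
      have h9 := congrArg τ.symm h
      rw [map_smul, τ.symm_apply_apply, e] at h9
      exact h9
    obtain ⟨u, hu, hu1, hu2⟩ := exists_unit_orth hH q ξ
    have e3 := congrArg (fun T : H →L[ℂ] H => T u) e2
    have e4 : ⟪q, u⟫_ℂ • p = l • (u + ⟪ξ, u⟫_ℂ • ξ) := e3
    rw [hu1, hu2, zero_smul, zero_smul, add_zero, eq_comm, smul_eq_zero] at e4
    rcases e4 with e4 | e4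
    · rw [e4, zero_smul, InnerProductSpace.rankOne_eq_zero] at e2
      rcases e2 with e2 | e2
      · simp [e2] at hp
      · simp [e2] at hq
    · simp [e4] at hu
  have hinj : ∀ y, Φ 1 y = 0 → y = 0 := by
    intro y hy
    obtain ⟨l, τ, h⟩ := hΦ 1
    have hl : l ≠ 0 := by rintro rfl; rw [zero_smul] at h; exact hne h
    rw [h] at hy
    have hy' : l • (τ 1 y) = 0 := hy
    exact iso_one_inj hH τ ((smul_eq_zero.1 hy').resolve_left hl)
  have hex : ∀ v : H, ∃ η, Φ 1 η = v ∧ ⟪v, η⟫_ℂ = ⟪v, v⟫_ℂ := by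
    intro v
    by_cases hv : v = 0
    · exact ⟨0, by simp [hv]⟩
    obtain ⟨s, hs0, hs⟩ := exists_normalize hv
    obtain ⟨y, hy, e⟩ := loc_one_aux hH hΦ hs
    rw [h0, InnerProductSpace.rankOne_apply] at e
    have hin : ⟪s • v, y⟫_ℂ ≠ 0 := by
      intro hz
      rw [hz, zero_smul] at e
      have := hinj y e
      simp [this] at hy
    refine ⟨(s⁻¹ * (⟪s • v, y⟫_ℂ)⁻¹) • y, ?_, ?_⟩
    · rw [map_smul, e, smul_smul, smul_smul]
      have : s⁻¹ * (⟪s • v, y⟫_ℂ)⁻¹ * ⟪s • v, y⟫_ℂ * s = 1 := by field_simp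
      rw [this, one_smul]
    · have h1 := inner_self_one hs
      rw [inner_smul_left, inner_smul_right] at h1
      have hs0' : starRingEnd ℂ s ≠ 0 := by simpa using hs0
      rw [inner_smul_left] at hin ⊢
      have hin2 : ⟪v, y⟫_ℂ ≠ 0 := fun h => hin (by rw [h, mul_zero])
      rw [inner_smul_right]
      field_simp
      linear_combination -h1
  have hB : ∀ η, ⟪(adjoint (Φ 1) * Φ 1 - adjoint (Φ 1)) η, η⟫_ℂ = 0 := by
    intro η
    obtain ⟨η', h1, h2⟩ := hex (Φ 1 η)
    have : η' = η := by
      have := hinj (η' - η) (by rw [map_sub, h1, sub_self])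
      exact sub_eq_zero.1 this
    rw [this] at h2
    -- ⟪Bη, η⟫ = ⟪Bη, Bη⟫
    have h3 : ⟪(adjoint (Φ 1) * Φ 1) η, η⟫_ℂ = ⟪Φ 1 η, Φ 1 η⟫_ℂ := by
      change ⟪adjoint (Φ 1) (Φ 1 η), η⟫_ℂ = _
      rw [adjoint_inner_left]
    rw [sub_apply, inner_sub_left, h3, adjoint_inner_left, ← inner_conj_symm η, h2,
      inner_conj_symm, sub_self]
  have hT : adjoint (Φ 1) * Φ 1 - adjoint (Φ 1) = 0 := by
    have := (inner_map_self_eq_zero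
      ((adjoint (Φ 1) * Φ 1 - adjoint (Φ 1) : H →L[ℂ] H) : H →ₗ[ℂ] H)).1 hB
    ext z
    exact congrArg (fun T : H →ₗ[ℂ] H => T z) this
  have hT' : adjoint (Φ 1) = adjoint (Φ 1) * Φ 1 := (sub_eq_zero.1 hT).symm
  have hsa : Φ 1 = adjoint (Φ 1) * Φ 1 := by
    have := congrArg adjoint hT'
    rw [adjoint_adjoint, mul_def, adjoint_comp, adjoint_adjoint] at this
    exact this
  have hidem : Φ 1 = Φ 1 * Φ 1 := by
    conv_lhs => rw [hsa]
    rw [← hT'] at hsa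
    rw [← hsa]
  ext z
  have := hinj (z - Φ 1 z) (by
    rw [map_sub, sub_eq_zero]
    exact congrArg (fun T : H →L[ℂ] H => T z) hidem)
  rw [sub_eq_zero] at this
  rw [← this]; rfl

/-- two-sided multiplication by unitaries -/
noncomputable def mulIso (u v : unitary (H →L[ℂ] H)) : Iso H where
  toFun A := u * A * v
  invFun A := star (u : H →L[ℂ] H) * A * star (v : H →L[ℂ] H)
  left_inv A := by
    have h1 : (v : H →L[ℂ] H) * star (v : H →L[ℂ] H) = 1 := Unitary.coe_mul_star_self v
    have h2 : star (u : H →L[ℂ] H) * (u : H →L[ℂ] H) = 1 := Unitary.coe_star_mul_self u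
    dsimp only
    rw [mul_assoc, mul_assoc, mul_assoc, h1, mul_one, ← mul_assoc, h2, one_mul]
  right_inv A := by
    have h1 : star (v : H →L[ℂ] H) * (v : H →L[ℂ] H) = 1 := Unitary.coe_star_mul_self v
    have h2 : (u : H →L[ℂ] H) * star (u : H →L[ℂ] H) = 1 := Unitary.coe_mul_star_self u
    dsimp only
    rw [mul_assoc, mul_assoc, mul_assoc, h1, mul_one, ← mul_assoc, h2, one_mul]
  map_add' A B := by simp [mul_add, add_mul]
  map_smul' c A := by simp
  norm_map' A := by simp

theorem loc_post (hΦ : Loc Φ) (σ : Iso H) :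
    Loc ((σ.toContinuousLinearEquiv : (H →L[ℂ] H) →L[ℂ] (H →L[ℂ] H)).comp Φ) := by
  intro A
  obtain ⟨l, τ, h⟩ := hΦ A
  refine ⟨l, τ.trans σ, ?_⟩
  simp [h]

theorem loc_pre (hΦ : Loc Φ) (σ : Iso H) :
    Loc (Φ.comp (σ.toContinuousLinearEquiv : (H →L[ℂ] H) →L[ℂ] (H →L[ℂ] H))) := by
  intro A
  obtain ⟨l, τ, h⟩ := hΦ (σ A)
  refine ⟨l, σ.trans τ, ?_⟩
  simp [h]

theorem loc_zero (hH : ¬ FiniteDimensional ℂ H) (hΦ : Loc Φ)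
    (h0 : ∀ x y : H, Φ (ro x y) = 0) : Φ = 0 := by
  have hu : ∀ u ∈ (unitary (H →L[ℂ] H) : Set (H →L[ℂ] H)), Φ u = 0 := by
    intro u hu
    have := loc_one_zero hH (loc_pre hΦ (mulIso ⟨u, hu⟩ 1)) (by
      intro x y
      have : (mulIso ⟨u, hu⟩ 1) (ro x y) = ro (u x) y := by
        simp [mulIso, mul_def, InnerProductSpace.comp_rankOne]
      simp [this, h0])
    simpa [mulIso] using this
  ext1 A
  have hA : A ∈ Submodule.span ℂ (unitary (H →L[ℂ] H) : Set (H →L[ℂ] H)) := by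
    rw [CStarAlgebra.span_unitary]; trivial
  induction hA using Submodule.span_induction with
  | mem x hx => exact hu x hx
  | zero => simp
  | add x y _ _ h1 h2 => rw [map_add, h1, h2]; simp
  | smul a x _ h => rw [map_smul, h]; simp

theorem loc_id (hH : ¬ FiniteDimensional ℂ H) (hΦ : Loc Φ)
    (h0 : ∀ x y : H, Φ (ro x y) = ro x y) : ∀ A, Φ A = A := by
  have hu : ∀ u ∈ (unitary (H →L[ℂ] H) : Set (H →L[ℂ] H)), Φ u = u := by
    intro u hu
    have hl := loc_post (loc_pre hΦ (mulIso ⟨u, hu⟩ 1)) (mulIso (star ⟨u, hu⟩) 1)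
    have := loc_one_id hH hl (by
      intro x y
      have : (mulIso ⟨u, hu⟩ 1) (ro x y) = ro (u x) y := by
        simp [mulIso, mul_def, InnerProductSpace.comp_rankOne]
      have h2 : star u (u x) = x :=
        congrArg (fun T : H →L[ℂ] H => T x) (Unitary.coe_star_mul_self ⟨u, hu⟩)
      simp [this, h0]
      simp [mulIso, mul_def, InnerProductSpace.comp_rankOne, h2])
    have h3 : star u * Φ u = 1 := by simpa [mulIso] using this
    have h4 := congrArg (fun T => u * T) h3
    have h5 : u * star u = 1 := Unitary.coe_mul_star_self ⟨u, hu⟩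
    simpa [← mul_assoc, h5] using h4
  intro A
  have hA : A ∈ Submodule.span ℂ (unitary (H →L[ℂ] H) : Set (H →L[ℂ] H)) := by
    rw [CStarAlgebra.span_unitary]; trivial
  induction hA using Submodule.span_induction with
  | mem x hx => exact hu x hx
  | zero => simp
  | add x y _ _ h1 h2 => rw [map_add, h1, h2]
  | smul a x _ h => rw [map_smul, h]

end Part2
end LocIso

namespace LocIso
section Part3
set_option linter.unusedSectionVars false
set_option linter.unusedSimpArgs false
open scoped InnerProductSpace
open ContinuousLinearMap

variable {H : Type*} [NormedAddCommGroup H] [InnerProductSpace ℂ H] [CompleteSpace H]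
variable {Φ : (H →L[ℂ] H) →L[ℂ] (H →L[ℂ] H)}

/-- globally a scalar multiple of a surjective isometry -/
def Good (Φ : (H →L[ℂ] H) →L[ℂ] (H →L[ℂ] H)) : Prop :=
  ∃ (l : ℂ) (τ : Iso H), ∀ A, Φ A = l • τ A

/-- composition with an isometry -/
noncomputable def post (σ : Iso H) (Φ : (H →L[ℂ] H) →L[ℂ] (H →L[ℂ] H)) :
    (H →L[ℂ] H) →L[ℂ] (H →L[ℂ] H) :=
  (σ.toContinuousLinearEquiv : (H →L[ℂ] H) →L[ℂ] (H →L[ℂ] H)).comp Φ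

theorem post_apply (σ : Iso H) (A : H →L[ℂ] H) : post σ Φ A = σ (Φ A) := rfl

theorem good_of_post (σ : Iso H) (h : Good (post σ Φ)) : Good Φ := by
  obtain ⟨l, τ, h⟩ := h
  refine ⟨l, τ.trans σ.symm, fun A => ?_⟩
  have := congrArg σ.symm (h A)
  rw [post_apply, σ.symm_apply_apply, map_smul] at this
  exact this

theorem loc_smul (hΦ : Loc Φ) (c : ℂ) : Loc (c • Φ) := by
  intro A
  obtain ⟨l, τ, h⟩ := hΦ A
  refine ⟨c * l, τ, ?_⟩
  rw [smul_apply, h, smul_smul]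

theorem good_of_smul {c : ℂ} (hc : c ≠ 0) (h : Good (c • Φ)) : Good Φ := by
  obtain ⟨l, τ, h⟩ := h
  refine ⟨c⁻¹ * l, τ, fun A => ?_⟩
  have := h A
  rw [smul_apply] at this
  rw [mul_smul, ← this, inv_smul_smul₀ hc]

theorem exists_nat_basis [TopologicalSpace.SeparableSpace H] (hH : ¬ FiniteDimensional ℂ H) :
    Nonempty (HilbertBasis ℕ ℂ H) := by
  obtain ⟨w, b, hb⟩ := exists_hilbertBasis ℂ H
  have hcount : Countable w := by
    refine Pairwise.countable_of_isOpen_disjoint (s := fun i : w => Metric.ball (b i) (1 / 2)) ?_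
      (fun _ => Metric.isOpen_ball) (fun i => ⟨b i, Metric.mem_ball_self (by norm_num)⟩)
    intro i j hij
    apply Metric.ball_disjoint_ball
    have h1 := norm_sub_sq (𝕜 := ℂ) (b i) (b j)
    rw [b.orthonormal.1, b.orthonormal.1, b.orthonormal.2 hij] at h1
    simp only [map_zero] at h1
    rw [dist_eq_norm]
    nlinarith [norm_nonneg (b i - b j)]
  have hinf : Infinite w := by
    by_contra h
    rw [not_infinite_iff_finite] at h
    have := Fintype.ofFinite w
    exact hH (Module.Finite.of_basis b.toOrthonormalBasis.toBasis)
  obtain ⟨e⟩ := nonempty_equiv_of_countable (α := ℕ) (β := w)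
  refine ⟨HilbertBasis.mk (v := b ∘ e) (b.orthonormal.comp e e.injective) ?_⟩
  rw [Set.range_comp, e.range_eq_univ, Set.image_univ, b.dense_span]

theorem basis_zero (b : HilbertBasis ℕ ℂ H) {z : H} (h : ∀ n, ⟪b n, z⟫_ℂ = 0) : z = 0 := by
  apply b.repr.injective
  ext n
  rw [b.repr_apply_apply, h]; simp

theorem basis_ext (b : HilbertBasis ℕ ℂ H) {z w : H} (h : ∀ n, ⟪b n, z⟫_ℂ = ⟪b n, w⟫_ℂ) :
    z = w := by
  rw [← sub_eq_zero]
  exact basis_zero b fun n => by rw [inner_sub_right, h, sub_self]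

theorem op_ext (b : HilbertBasis ℕ ℂ H) {A B : H →L[ℂ] H}
    (h : ∀ k l, ⟪b k, A (b l)⟫_ℂ = ⟪b k, B (b l)⟫_ℂ) : A = B := by
  refine ContinuousLinearMap.ext_on (s := Set.range b) ?_ ?_
  · have := b.dense_span
    rw [Submodule.dense_iff_topologicalClosure_eq_top]
    exact this
  · rintro _ ⟨l, rfl⟩
    exact basis_ext b fun k => h k l

theorem b_ne (b : HilbertBasis ℕ ℂ H) {i j : ℕ} (h : i ≠ j) : ⟪b i, b j⟫_ℂ = 0 :=
  b.orthonormal.2 h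

theorem b_norm (b : HilbertBasis ℕ ℂ H) (i : ℕ) : ‖b i‖ = 1 := b.orthonormal.1 i

theorem b_self (b : HilbertBasis ℕ ℂ H) (i : ℕ) : ⟪b i, b i⟫_ℂ = 1 := inner_self_one (b_norm b i)

theorem iso_complete (hH : ¬ FiniteDimensional ℂ H) (τ : Iso H) (b : HilbertBasis ℕ ℂ H)
    {r s : ℕ → H} (hr : ∀ n, ‖r n‖ = 1) (hs : ∀ n, ‖s n‖ = 1)
    (h : ∀ n, τ (ro (b n) (b n)) = ro (r n) (s n)) :
    (∀ z, (∀ n, ⟪s n, z⟫_ℂ = 0) → z = 0) ∧ (∀ z, (∀ n, ⟪r n, z⟫_ℂ = 0) → z = 0) := by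
  have horth : ∀ n m, n ≠ m → ⟪r n, r m⟫_ℂ = 0 ∧ ⟪s n, s m⟫_ℂ = 0 := by
    intro n m hnm
    have hk := iso_kill τ (b_norm b n) (b_norm b n) (hr n) (hs n) (h n)
      ((kill_ro (b_norm b m) (b_norm b m) (b_norm b n) (b_norm b n)).2 ⟨b_ne b hnm, b_ne b hnm⟩)
    rw [h m, kill_ro (hr m) (hs m) (hr n) (hs n)] at hk
    exact hk
  have key : ∀ x y, ‖x‖ = 1 → ‖y‖ = 1 → (∀ n, n ≠ 0 → ⟪r n, x⟫_ℂ = 0 ∧ ⟪s n, y⟫_ℂ = 0) →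
      ∃ c : ℂ, ro x y = c • ro (r 0) (s 0) := by
    intro x y hx hy hxy
    obtain ⟨g, k, hg, hk, e⟩ := iso_ro hH τ.symm hx hy
    have hgk : ∀ n, n ≠ 0 → ⟪b n, g⟫_ℂ = 0 ∧ ⟪b n, k⟫_ℂ = 0 := by
      intro n hn
      have e2 : τ.symm (ro (r n) (s n)) = ro (b n) (b n) := by
        rw [← h n, τ.symm_apply_apply]
      have hk' := iso_kill τ.symm (hr n) (hs n) (b_norm b n) (b_norm b n) e2
        ((kill_ro hx hy (hr n) (hs n)).2 (hxy n hn))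
      rw [e, kill_ro hg hk (b_norm b n) (b_norm b n)] at hk'
      exact hk'
    have hg' : g = ⟪b 0, g⟫_ℂ • b 0 := by
      apply basis_ext b
      intro n
      rw [inner_smul_right]
      by_cases hn : n = 0
      · rw [hn, b_self, mul_one]
      · rw [(hgk n hn).1, b_ne b hn, mul_zero]
    have hk' : k = ⟪b 0, k⟫_ℂ • b 0 := by
      apply basis_ext b
      intro n
      rw [inner_smul_right]
      by_cases hn : n = 0
      · rw [hn, b_self, mul_one]
      · rw [(hgk n hn).2, b_ne b hn, mul_zero]
    generalize ⟪b 0, g⟫_ℂ = c1 at hg'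
    generalize ⟪b 0, k⟫_ℂ = c2 at hk'
    refine ⟨c1 * starRingEnd ℂ c2, ?_⟩
    have e3 : ro g k = (c1 * starRingEnd ℂ c2) • ro (b 0) (b 0) := by
      ext z
      rw [hg', hk']
      simp only [smul_apply, InnerProductSpace.rankOne_apply, inner_smul_left]
      module
    rw [e3] at e
    have := congrArg τ e
    rw [τ.apply_symm_apply, map_smul, h 0] at this
    exact this
  have hr0 : r 0 ≠ 0 := by intro h0; have := hr 0; simp [h0] at this
  have hs0 : s 0 ≠ 0 := by intro h0; have := hs 0; simp [h0] at this
  constructor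
  · intro z hz
    by_contra hz0
    obtain ⟨t, ht0, ht⟩ := exists_normalize hz0
    obtain ⟨c, hc⟩ := key (r 0) (t • z) (hr 0) ht (fun n hn =>
      ⟨(horth n 0 hn).1, by rw [inner_smul_right, hz, mul_zero]⟩)
    have h2 := congrArg (fun T : H →L[ℂ] H => T (t • z)) hc
    simp only [smul_apply, InnerProductSpace.rankOne_apply] at h2
    rw [inner_self_one ht, inner_smul_right, hz, mul_zero, zero_smul, smul_zero, one_smul] at h2
    exact hr0 h2
  · intro z hz
    by_contra hz0
    obtain ⟨t, ht0, ht⟩ := exists_normalize hz0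
    obtain ⟨c, hc⟩ := key (t • z) (s 0) ht (hs 0) (fun n hn =>
      ⟨by rw [inner_smul_right, hz, mul_zero], (horth n 0 hn).2⟩)
    have h2 := congrArg (fun T : H →L[ℂ] H => ⟪t • z, T (s 0)⟫_ℂ) hc
    simp only [smul_apply, InnerProductSpace.rankOne_apply, inner_smul_right] at h2
    rw [inner_self_one (hs 0)] at h2
    simp only [inner_smul_left, inner_eq_zero_symm.1 (hz 0)] at h2
    simp [ht0, hz0] at h2

theorem loc_complete (hH : ¬ FiniteDimensional ℂ H) (hΦ : Loc Φ) (b : HilbertBasis ℕ ℂ H)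
    {p q : ℕ → H} (hp0 : p 0 ≠ 0) (hq0 : q 0 ≠ 0)
    (hp : ∀ n, n ≠ 0 → ⟪p 0, p n⟫_ℂ = 0)
    (h : ∀ n, Φ (ro (b n) (b n)) = ro (p n) (q n)) :
    (∀ z, (∀ n, ⟪q n, z⟫_ℂ = 0) → z = 0) ∧ (∀ z, (∀ n, ⟪p n, z⟫_ℂ = 0) → z = 0) := by
  let a : ℕ → ℂ := fun n => (1 / 2) ^ n
  have ha : ∀ n, a n ≠ 0 := fun n => pow_ne_zero _ (by norm_num)
  have hsum : Summable (fun n => a n • ro (b n) (b n)) := by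
    refine Summable.of_norm_bounded (g := fun n => (1 / 2 : ℝ) ^ n) summable_geometric_two ?_
    intro n
    rw [norm_smul, InnerProductSpace.norm_rankOne, b_norm]
    simp [a]
  obtain ⟨A, hA⟩ := hsum
  have hL : ∀ (L : (H →L[ℂ] H) →L[ℂ] ℂ) (n : ℕ), (∀ m, m ≠ n → L (ro (b m) (b m)) = 0) →
      L A = a n * L (ro (b n) (b n)) := by
    intro L n hn
    have h1 := L.hasSum hA
    have h2 := hasSum_single (f := fun m => L (a m • ro (b m) (b m))) n (fun m hm => by
      rw [map_smul, hn m hm, smul_zero])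
    have h3 := h1.unique h2
    rw [h3, map_smul, smul_eq_mul]
  -- functionals
  let F : H → H → (H →L[ℂ] H) →L[ℂ] ℂ := fun u w =>
    (innerSL ℂ u).comp (ContinuousLinearMap.apply ℂ H w)
  have hF : ∀ u w T, F u w T = ⟪u, T w⟫_ℂ := fun u w T => rfl
  obtain ⟨l, τ, e⟩ := hΦ A
  have hl : l ≠ 0 := by
    rintro rfl
    rw [zero_smul] at e
    have h1 := hL ((F (p 0) (q 0)).comp Φ) 0 (fun m hm => by
      rw [comp_apply, hF, h, InnerProductSpace.rankOne_apply, inner_smul_right, hp m hm,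
        mul_zero])
    rw [comp_apply, hF, e, comp_apply, hF, h, InnerProductSpace.rankOne_apply,
      inner_smul_right, zero_apply, inner_zero_right] at h1
    have h2 := ha 0
    have h3 : ⟪p 0, p 0⟫_ℂ ≠ 0 := inner_self_ne_zero.2 hp0
    have h4 : ⟪q 0, q 0⟫_ℂ ≠ 0 := inner_self_ne_zero.2 hq0
    exact (mul_ne_zero h2 (mul_ne_zero h4 h3)) h1.symm
  choose r s hr hs hrs using fun n => iso_ro hH τ (b_norm b n) (b_norm b n)
  obtain ⟨c1, c2⟩ := iso_complete hH τ b hr hs hrs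
  have hk : ∀ n, Kill (A - a n • ro (b n) (b n)) (b n) (b n) := by
    intro n
    constructor
    · refine ext_inner_left ℂ fun u => ?_
      have := hL (F u (b n)) n (fun m hm => by
        rw [hF, InnerProductSpace.rankOne_apply, b_ne b hm, zero_smul, inner_zero_right])
      rw [hF, hF] at this
      rw [sub_apply, inner_sub_right, this, smul_apply, inner_smul_right, sub_self,
        inner_zero_right]
    · refine ext_inner_right ℂ fun u => ?_
      have := hL (F (b n) u) n (fun m hm => by
        rw [hF, InnerProductSpace.rankOne_apply, inner_smul_right, b_ne b hm.symm, mul_zero])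
      rw [hF, hF] at this
      rw [adjoint_inner_left, sub_apply, inner_sub_right, this, smul_apply, inner_smul_right,
        sub_self, inner_zero_left]
  have hk2 : ∀ n, Kill (τ A - a n • ro (r n) (s n)) (r n) (s n) := by
    intro n
    have := iso_kill τ (b_norm b n) (b_norm b n) (hr n) (hs n) (hrs n) (hk n)
    rwa [map_sub, map_smul, hrs] at this
  constructor
  · intro z hz
    apply c1
    intro n
    have h0 : Φ A z = 0 := by
      refine ext_inner_left ℂ fun u => ?_
      have := hL ((F u z).comp Φ) 0 (fun m hm => by
        rw [comp_apply, hF, h, InnerProductSpace.rankOne_apply, hz, zero_smul, inner_zero_right])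
      rw [comp_apply, hF, comp_apply, hF, h, InnerProductSpace.rankOne_apply, hz, zero_smul,
        inner_zero_right, mul_zero] at this
      rw [this, inner_zero_right]
    rw [e, smul_apply] at h0
    have h1 := (smul_eq_zero.1 h0).resolve_left hl
    have h2 := congrArg (fun v => ⟪v, z⟫_ℂ) (hk2 n).2
    simp only [adjoint_inner_left, sub_apply, smul_apply, h1, inner_zero_left,
      InnerProductSpace.rankOne_apply, inner_sub_right, inner_zero_right, inner_smul_right,
      inner_self_one (hr n)] at h2
    simpa [ha n] using h2
  · intro z hz
    apply c2
    intro n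
    have h0 : ∀ w, ⟪z, Φ A w⟫_ℂ = 0 := by
      intro w
      have hz' : ∀ n, ⟪z, p n⟫_ℂ = 0 := fun n => inner_eq_zero_symm.1 (hz n)
      have := hL ((F z w).comp Φ) 0 (fun m hm => by
        rw [comp_apply, hF, h, InnerProductSpace.rankOne_apply, inner_smul_right, hz', mul_zero])
      rw [comp_apply, hF, comp_apply, hF, h, InnerProductSpace.rankOne_apply, inner_smul_right,
        hz', mul_zero, mul_zero] at this
      exact this
    have h1 := h0 (s n)
    rw [e, smul_apply, inner_smul_right] at h1
    have h1 := (mul_eq_zero.1 h1).resolve_left hl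
    have h2 := congrArg (fun v => ⟪z, v⟫_ℂ) (hk2 n).1
    simp only [sub_apply, smul_apply, h1, InnerProductSpace.rankOne_apply, inner_sub_right,
      inner_zero_right, inner_smul_right, inner_self_one (hs n)] at h2
    rw [inner_eq_zero_symm]
    simpa [ha n] using h2

/-- two-sided composition with unitaries -/
noncomputable def lIso (U V : H ≃ₗᵢ[ℂ] H) : Iso H :=
  mulIso (Unitary.linearIsometryEquiv.symm U) (Unitary.linearIsometryEquiv.symm V)

theorem lIso_apply (U V : H ≃ₗᵢ[ℂ] H) (A : H →L[ℂ] H) (z : H) :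
    lIso U V A z = U (A (V z)) := rfl

theorem lIso_ro (U V : H ≃ₗᵢ[ℂ] H) (x y : H) : lIso U V (ro x y) = ro (U x) (V.symm y) := by
  ext z
  rw [lIso_apply, InnerProductSpace.rankOne_apply, InnerProductSpace.rankOne_apply, map_smul]
  congr 1
  rw [← V.inner_map_map (V.symm y), V.apply_symm_apply]

/-- the unitary carrying one Hilbert basis to another one -/
noncomputable def chg (b b' : HilbertBasis ℕ ℂ H) : H ≃ₗᵢ[ℂ] H := b.repr.trans b'.repr.symm

theorem chg_apply (b b' : HilbertBasis ℕ ℂ H) (n : ℕ) : chg b b' (b n) = b' n := by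
  simp only [chg, LinearIsometryEquiv.trans_apply]
  rw [b.repr_self, b'.repr_symm_single]

theorem mk_basis {v : ℕ → H} (hv : Orthonormal ℂ v) (hc : ∀ z, (∀ n, ⟪v n, z⟫_ℂ = 0) → z = 0) :
    ∃ b : HilbertBasis ℕ ℂ H, ∀ n, b n = v n := by
  have h : (Submodule.span ℂ (Set.range v))ᗮ = ⊥ := by
    rw [Submodule.eq_bot_iff]
    intro z hz
    rw [Submodule.mem_orthogonal] at hz
    exact hc z fun n => hz _ (Submodule.subset_span ⟨n, rfl⟩)
  exact ⟨HilbertBasis.mkOfOrthogonalEqBot hv h, fun n => by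
    rw [HilbertBasis.coe_mkOfOrthogonalEqBot]⟩

/-- normalization on diagonal rank one projections -/
theorem step_one (hH : ¬ FiniteDimensional ℂ H) (hΦ : Loc Φ) (b : HilbertBasis ℕ ℂ H)
    (h0 : Φ (ro (b 0) (b 0)) ≠ 0) :
    ∃ Ψ : (H →L[ℂ] H) →L[ℂ] (H →L[ℂ] H), Loc Ψ ∧ (∀ n, Ψ (ro (b n) (b n)) = ro (b n) (b n)) ∧
      (Good Ψ → Good Φ) := by
  choose p q hq hpq using fun n => loc_ro hH hΦ (b_norm b n) (b_norm b n)
  have hp0 : p 0 ≠ 0 := by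
    intro h
    apply h0
    rw [hpq, h]
    ext; simp
  have hp0n : ‖p 0‖ ≠ 0 := norm_ne_zero_iff.2 hp0
  have hpn : ∀ n, ‖p n‖ = ‖p 0‖ := by
    intro n
    have := loc_const hH hΦ (b_norm b n) (b_norm b n) (b_norm b 0) (b_norm b 0)
    rw [hpq, hpq, InnerProductSpace.norm_rankOne, InnerProductSpace.norm_rankOne, hq, hq] at this
    simpa using this
  have hpne : ∀ n, p n ≠ 0 := by
    intro n h
    have := hpn n
    rw [h, norm_zero] at this
    exact hp0n this.symm
  have horth : ∀ n m, n ≠ m → ⟪p n, p m⟫_ℂ = 0 ∧ ⟪q n, q m⟫_ℂ = 0 := by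
    intro n m hnm
    rcases loc_pair hH hΦ (b_norm b n) (b_norm b n) (b_norm b m) (b_norm b m) (b_ne b hnm)
      (b_ne b hnm) (hq n) (hq m) (hpq n) (hpq m) with h | h
    · exact absurd h.1 (hpne n)
    · exact h.2
  have hq0 : q 0 ≠ 0 := by intro h; have := hq 0; simp [h] at this
  obtain ⟨c1, c2⟩ := loc_complete hH hΦ b hp0 hq0 (fun n hn => (horth 0 n hn.symm).1) hpq
  let c : ℂ := ((‖p 0‖ : ℝ) : ℂ)
  have hc : c ≠ 0 := by simpa [c] using hp0
  obtain ⟨Q, hQ⟩ := mk_basis (v := q) ⟨hq, fun n m h => (horth n m h).2⟩ c1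
  obtain ⟨P, hP⟩ := mk_basis (v := fun n => c⁻¹ • p n)
    ⟨fun n => by rw [norm_smul, hpn]; simp [c, hp0n],
      fun n m h => by
        change ⟪c⁻¹ • p n, c⁻¹ • p m⟫_ℂ = 0
        rw [inner_smul_left, inner_smul_right, (horth n m h).1, mul_zero, mul_zero]⟩
    (fun z hz => c2 z fun n => by
      have := hz n
      rw [inner_smul_left] at this
      refine (mul_eq_zero.1 this).resolve_left ?_
      simpa using hc)
  refine ⟨c⁻¹ • post (lIso (chg P b) (chg b Q)) Φ, loc_smul (loc_post hΦ _) _, fun n => ?_,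
    fun hg => good_of_post _ (good_of_smul (inv_ne_zero hc) hg)⟩
  rw [smul_apply, post_apply, hpq, lIso_ro]
  have e1 : (chg b Q).symm (q n) = b n := by
    rw [LinearIsometryEquiv.symm_apply_eq, chg_apply, hQ]
  have e2 : c⁻¹ • (chg P b) (p n) = b n := by
    rw [← map_smul, ← chg_apply P b n, hP]
  rw [e1]
  ext z
  simp only [smul_apply, InnerProductSpace.rankOne_apply]
  rw [smul_comm, e2]

theorem full_of_basis (b : HilbertBasis ℕ ℂ H)
    (h : ∀ i j, Φ (ro (b i) (b j)) = ro (b i) (b j)) (x y : H) : Φ (ro x y) = ro x y := by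
  have hd : Dense (Submodule.span ℂ (Set.range b) : Set H) := by
    rw [Submodule.dense_iff_topologicalClosure_eq_top]
    exact b.dense_span
  have h1 : ∀ i, ∀ y, Φ (ro (b i) y) = ro (b i) y := by
    intro i y
    have : Φ.comp (InnerProductSpace.rankOne ℂ (b i)) = InnerProductSpace.rankOne ℂ (b i) := by
      refine ContinuousLinearMap.ext_on hd ?_
      rintro _ ⟨j, rfl⟩
      exact h i j
    exact congrArg (fun T : H →L⋆[ℂ] (H →L[ℂ] H) => T y) this
  have : Φ.comp ((InnerProductSpace.rankOne ℂ).flip y) = (InnerProductSpace.rankOne ℂ).flip y := by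
    refine ContinuousLinearMap.ext_on hd ?_
    rintro _ ⟨i, rfl⟩
    exact h1 i y
  exact congrArg (fun T : H →L[ℂ] (H →L[ℂ] H) => T x) this

end Part3
end LocIso

namespace LocIso
section Part4
set_option linter.unusedSectionVars false
set_option linter.unusedSimpArgs false
open scoped InnerProductSpace
open ContinuousLinearMap

variable {H : Type*} [NormedAddCommGroup H] [InnerProductSpace ℂ H] [CompleteSpace H]
variable {Φ : (H →L[ℂ] H) →L[ℂ] (H →L[ℂ] H)}

/-- complex conjugation with respect to a Hilbert basis -/
noncomputable def cj (b : HilbertBasis ℕ ℂ H) : H ≃ₗᵢ⋆[ℂ] H :=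
  (b.repr.trans (starₗᵢ ℂ : lp (fun _ : ℕ => ℂ) 2 ≃ₗᵢ⋆[ℂ] lp (fun _ : ℕ => ℂ) 2)).trans
    b.repr.symm

theorem cj_apply (b : HilbertBasis ℕ ℂ H) (x : H) : cj b x = b.repr.symm (star (b.repr x)) := rfl

theorem cj_coord (b : HilbertBasis ℕ ℂ H) (x : H) (n : ℕ) :
    ⟪b n, cj b x⟫_ℂ = starRingEnd ℂ ⟪b n, x⟫_ℂ := by
  rw [← b.repr_apply_apply, cj_apply, b.repr.apply_symm_apply, lp.star_apply,
    b.repr_apply_apply]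
  rfl

theorem cj_cj (b : HilbertBasis ℕ ℂ H) (x : H) : cj b (cj b x) = x := by
  apply basis_ext b
  intro n
  rw [cj_coord, cj_coord, Complex.conj_conj]

theorem cj_inner (b : HilbertBasis ℕ ℂ H) (x y : H) : ⟪cj b x, cj b y⟫_ℂ = ⟪y, x⟫_ℂ := by
  rw [← b.tsum_inner_mul_inner, ← b.tsum_inner_mul_inner]
  congr 1
  ext n
  rw [cj_coord, ← inner_conj_symm (cj b x), cj_coord, Complex.conj_conj, inner_conj_symm,
    mul_comm]

theorem cj_b (b : HilbertBasis ℕ ℂ H) (n : ℕ) : cj b (b n) = b n := by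
  apply basis_ext b
  intro k
  rw [cj_coord]
  by_cases h : k = n
  · rw [h, b_self]; simp
  · rw [b_ne b h]; simp

/-- the transpose -/
noncomputable def tr (b : HilbertBasis ℕ ℂ H) (A : H →L[ℂ] H) : H →L[ℂ] H :=
  ((cj b).toContinuousLinearEquiv : H →L⋆[ℂ] H).comp
    ((adjoint A).comp ((cj b).toContinuousLinearEquiv : H →L⋆[ℂ] H))

theorem tr_apply (b : HilbertBasis ℕ ℂ H) (A : H →L[ℂ] H) (z : H) :
    tr b A z = cj b (adjoint A (cj b z)) := rfl

theorem tr_inner (b : HilbertBasis ℕ ℂ H) (A : H →L[ℂ] H) (w z : H) :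
    ⟪w, tr b A z⟫_ℂ = ⟪cj b z, A (cj b w)⟫_ℂ := by
  conv_lhs => rw [tr_apply, ← cj_cj b w]
  rw [cj_inner, adjoint_inner_left]

theorem tr_tr (b : HilbertBasis ℕ ℂ H) (A : H →L[ℂ] H) : tr b (tr b A) = A := by
  ext z
  refine ext_inner_left ℂ fun w => ?_
  rw [tr_inner, tr_inner, cj_cj, cj_cj]

theorem tr_le (b : HilbertBasis ℕ ℂ H) (A : H →L[ℂ] H) : ‖tr b A‖ ≤ ‖A‖ := by
  refine opNorm_le_bound _ (norm_nonneg _) fun z => ?_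
  rw [tr_apply, LinearIsometryEquiv.norm_map]
  refine ((adjoint A).le_opNorm _).trans ?_
  rw [LinearIsometryEquiv.norm_map, LinearIsometryEquiv.norm_map]

/-- the transpose as an isometry -/
noncomputable def trIso (b : HilbertBasis ℕ ℂ H) : Iso H where
  toFun := tr b
  invFun := tr b
  left_inv := tr_tr b
  right_inv := tr_tr b
  map_add' A B := by
    ext z
    refine ext_inner_left ℂ fun w => ?_
    rw [add_apply, inner_add_right, tr_inner, tr_inner, tr_inner, add_apply, inner_add_right]
  map_smul' c A := by
    ext z
    refine ext_inner_left ℂ fun w => ?_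
    rw [RingHom.id_apply, smul_apply, inner_smul_right, tr_inner, tr_inner, smul_apply,
      inner_smul_right]
  norm_map' A := by
    refine le_antisymm (tr_le b A) ?_
    have := tr_le b (tr b A)
    rw [tr_tr] at this
    exact this

theorem trIso_ro (b : HilbertBasis ℕ ℂ H) (i j : ℕ) :
    trIso b (ro (b i) (b j)) = ro (b j) (b i) := by
  change tr b (ro (b i) (b j)) = ro (b j) (b i)
  ext z
  refine ext_inner_left ℂ fun w => ?_
  have h1 : ⟪cj b z, b i⟫_ℂ = ⟪b i, z⟫_ℂ := by
    conv_lhs => rw [← cj_b b i]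
    rw [cj_inner]
  have h2 : ⟪b j, cj b w⟫_ℂ = ⟪w, b j⟫_ℂ := by
    conv_lhs => rw [← cj_b b j]
    rw [cj_inner]
  rw [tr_inner, InnerProductSpace.rankOne_apply, InnerProductSpace.rankOne_apply,
    inner_smul_right, inner_smul_right, h1, h2, mul_comm]

/-- the images of rank one operators have rank at most one -/
theorem loc_r1 (hH : ¬ FiniteDimensional ℂ H) (hΦ : Loc Φ) (x y : H) : R1 (Φ (ro x y)) := by
  have hz : R1 (0 : H →L[ℂ] H) := by intro a b c d; simp
  by_cases hx : x = 0
  · have : ro x y = 0 := by rw [hx]; ext; simp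
    rw [this, map_zero]; exact hz
  by_cases hy : y = 0
  · have : ro x y = 0 := by rw [hy]; ext; simp
    rw [this, map_zero]; exact hz
  obtain ⟨s, hs0, hs⟩ := exists_normalize hx
  obtain ⟨t, ht0, ht⟩ := exists_normalize hy
  obtain ⟨p, q, -, e⟩ := loc_ro hH hΦ hs ht
  have h1 : ro (s • x) (t • y) = (s * starRingEnd ℂ t) • ro x y := by
    ext z
    simp only [smul_apply, InnerProductSpace.rankOne_apply, inner_smul_left]
    module
  have h2 : s * starRingEnd ℂ t ≠ 0 := mul_ne_zero hs0 (by simpa using ht0)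
  rw [h1, map_smul] at e
  have h3 : Φ (ro x y) = (s * starRingEnd ℂ t)⁻¹ • ro p q := by
    rw [← e, inv_smul_smul₀ h2]
  rw [h3]
  exact r1_smul (r1_ro p q) _

theorem ro_add_left (x y z : H) : ro (x + y) z = ro x z + ro y z := by
  ext w; simp only [add_apply, InnerProductSpace.rankOne_apply, smul_add]

theorem ro_add_right (x y z : H) : ro x (y + z) = ro x y + ro x z := by
  ext w; simp only [add_apply, InnerProductSpace.rankOne_apply, inner_add_left, add_smul]

theorem ent_ro (b : HilbertBasis ℕ ℂ H) (i j k l : ℕ) :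
    ⟪b k, ro (b i) (b j) (b l)⟫_ℂ = if k = i ∧ j = l then 1 else 0 := by
  rw [InnerProductSpace.rankOne_apply, inner_smul_right]
  by_cases h1 : k = i
  · by_cases h2 : j = l
    · subst h1 h2; rw [b_self, b_self]; simp
    · rw [b_ne b h2]; simp [h2]
  · rw [b_ne b h1]; simp [h1]

/-- entries of the image of a matrix unit -/
theorem loc_unit (hH : ¬ FiniteDimensional ℂ H) (hΦ : Loc Φ) (b : HilbertBasis ℕ ℂ H)
    (hd : ∀ n, Φ (ro (b n) (b n)) = ro (b n) (b n)) {i j : ℕ} (hij : i ≠ j) :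
    ∃ α : ℂ, ‖α‖ = 1 ∧ (Φ (ro (b i) (b j)) = α • ro (b i) (b j) ∨
      Φ (ro (b i) (b j)) = α • ro (b j) (b i)) := by
  have hR := loc_r1 hH hΦ (b i) (b j)
  have hR1 := loc_r1 hH hΦ (b i) (b i + b j)
  have hR2 := loc_r1 hH hΦ (b i + b j) (b j)
  have hn : ‖Φ (ro (b i) (b j))‖ = 1 := by
    rw [loc_const hH hΦ (b_norm b i) (b_norm b j) (b_norm b i) (b_norm b i), hd,
      InnerProductSpace.norm_rankOne, b_norm, one_mul]
  have hout : ∀ k, k ≠ i → k ≠ j → ∀ l, ⟪b k, Φ (ro (b i) (b j)) (b l)⟫_ℂ = 0 ∧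
      ⟪b l, Φ (ro (b i) (b j)) (b k)⟫_ℂ = 0 := by
    intro k hki hkj l
    obtain ⟨p, q, hq, e⟩ := loc_ro hH hΦ (b_norm b i) (b_norm b j)
    rcases loc_pair hH hΦ (b_norm b i) (b_norm b j) (b_norm b k) (b_norm b k) (b_ne b hki.symm)
      (b_ne b hkj.symm) hq (b_norm b k) e (hd k) with h | h
    · have := b_norm b k
      rw [h.2, norm_zero] at this
      norm_num at this
    · rw [e, InnerProductSpace.rankOne_apply, InnerProductSpace.rankOne_apply, h.2.2,
        inner_smul_right, inner_eq_zero_symm.1 h.2.1]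
      simp
  rw [ro_add_right, map_add, hd] at hR1
  rw [ro_add_left, map_add, hd] at hR2
  generalize Φ (ro (b i) (b j)) = m at *
  have e0 := hR (b i) (b i) (b j) (b j)
  have e1 := hR1 (b i) (b i) (b j) (b j)
  have e2 := hR2 (b i) (b i) (b j) (b j)
  simp only [add_apply, inner_add_right, ent_ro, hij, hij.symm, and_true, true_and, if_true,
    and_false, false_and, if_false, add_zero, zero_add, and_self] at e1 e2
  have hjj : ⟪b j, m (b j)⟫_ℂ = 0 := by linear_combination e1 - e0
  have hii : ⟪b i, m (b i)⟫_ℂ = 0 := by linear_combination e2 - e0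
  rw [hii, zero_mul, eq_comm, mul_eq_zero] at e0
  have hm : m = ⟪b i, m (b j)⟫_ℂ • ro (b i) (b j) + ⟪b j, m (b i)⟫_ℂ • ro (b j) (b i) := by
    apply op_ext b
    intro k l
    simp only [add_apply, inner_add_right, smul_apply, inner_smul_right, ent_ro]
    by_cases hki : k = i
    · subst hki
      by_cases hlk : l = k
      · subst hlk; simp [hii, hij, hij.symm]
      by_cases hlj : l = j
      · subst hlj; simp [hij]
      · rw [(hout l hlk hlj k).2]; simp [Ne.symm hlk, Ne.symm hlj]
    by_cases hkj : k = j
    · subst hkj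
      by_cases hlk : l = k
      · subst hlk; simp [hjj, hij, hij.symm]
      by_cases hli : l = i
      · subst hli; simp [hij.symm]
      · rw [(hout l hli hlk k).2]; simp [Ne.symm hlk, Ne.symm hli]
    · rw [(hout k hki hkj l).1]; simp [hki, hkj]
  rcases e0 with e0 | e0
  · rw [e0, zero_smul, zero_add] at hm
    refine ⟨_, ?_, Or.inr hm⟩
    rw [hm, norm_smul, InnerProductSpace.norm_rankOne, b_norm, b_norm, mul_one, mul_one] at hn
    exact hn
  · rw [e0, zero_smul, add_zero] at hm
    refine ⟨_, ?_, Or.inl hm⟩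
    rw [hm, norm_smul, InnerProductSpace.norm_rankOne, b_norm, b_norm, mul_one, mul_one] at hn
    exact hn

/-- the matrix unit is mapped to a multiple of itself -/
def Fx (Φ : (H →L[ℂ] H) →L[ℂ] (H →L[ℂ] H)) (b : HilbertBasis ℕ ℂ H) (i j : ℕ) : Prop :=
  ∃ α : ℂ, ‖α‖ = 1 ∧ Φ (ro (b i) (b j)) = α • ro (b i) (b j)

theorem ne_zero_of_norm {α : ℂ} (h : ‖α‖ = 1) : α ≠ 0 := by
  rintro rfl; simp at h

theorem fx_right (hH : ¬ FiniteDimensional ℂ H) (hΦ : Loc Φ) (b : HilbertBasis ℕ ℂ H)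
    (hd : ∀ n, Φ (ro (b n) (b n)) = ro (b n) (b n)) {i j k : ℕ} (hij : i ≠ j) (hik : i ≠ k)
    (h : Fx Φ b i j) : Fx Φ b i k := by
  by_cases hjk : j = k
  · rwa [← hjk]
  obtain ⟨α, hα, h⟩ := h
  obtain ⟨β, hβ, h' | h'⟩ := loc_unit hH hΦ b hd hik
  · exact ⟨β, hβ, h'⟩
  exfalso
  have hR := loc_r1 hH hΦ (b i) (b j + b k)
  rw [ro_add_right, map_add, h, h'] at hR
  have e := hR (b i) (b j) (b k) (b i)
  simp [-InnerProductSpace.rankOne_apply, add_apply, inner_add_right, smul_apply,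
    inner_smul_right, ent_ro, hij, hij.symm, hik, hik.symm, hjk, Ne.symm hjk,
    ne_zero_of_norm hα, ne_zero_of_norm hβ] at e

theorem fx_left (hH : ¬ FiniteDimensional ℂ H) (hΦ : Loc Φ) (b : HilbertBasis ℕ ℂ H)
    (hd : ∀ n, Φ (ro (b n) (b n)) = ro (b n) (b n)) {i j k : ℕ} (hij : i ≠ j) (hkj : k ≠ j)
    (h : Fx Φ b i j) : Fx Φ b k j := by
  by_cases hik : i = k
  · rwa [← hik]
  obtain ⟨α, hα, h⟩ := h
  obtain ⟨β, hβ, h' | h'⟩ := loc_unit hH hΦ b hd hkj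
  · exact ⟨β, hβ, h'⟩
  exfalso
  have hR := loc_r1 hH hΦ (b i + b k) (b j)
  rw [ro_add_left, map_add, h, h'] at hR
  have e := hR (b i) (b j) (b j) (b k)
  simp [-InnerProductSpace.rankOne_apply, add_apply, inner_add_right, smul_apply,
    inner_smul_right, ent_ro, hij, hij.symm, hik, Ne.symm hik, hkj, hkj.symm,
    ne_zero_of_norm hα, ne_zero_of_norm hβ] at e

theorem fx_all (hH : ¬ FiniteDimensional ℂ H) (hΦ : Loc Φ) (b : HilbertBasis ℕ ℂ H)
    (hd : ∀ n, Φ (ro (b n) (b n)) = ro (b n) (b n)) (h : Fx Φ b 0 1) (i j : ℕ) :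
    Fx Φ b i j := by
  by_cases hij : i = j
  · subst hij
    exact ⟨1, by simp, by rw [hd, one_smul]⟩
  have key : ∀ i j, i ≠ j → j ≠ 0 → Fx Φ b i j := by
    intro i j hij hj
    exact fx_left hH hΦ b hd hj.symm hij (fx_right hH hΦ b hd (by norm_num) hj.symm h)
  by_cases hj : j = 0
  · exact fx_right hH hΦ b hd (j := i + 1) (by omega) hij (key i (i + 1) (by omega) (by omega))
  · exact key i j hij hj

theorem good_of_fx (hH : ¬ FiniteDimensional ℂ H) (hΦ : Loc Φ) (b : HilbertBasis ℕ ℂ H)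
    (hd : ∀ n, Φ (ro (b n) (b n)) = ro (b n) (b n)) (h : Fx Φ b 0 1) : Good Φ := by
  choose α hα hαe using fx_all hH hΦ b hd h
  have hdiag : ∀ i, α i i = 1 := by
    intro i
    have := congrArg (fun T : H →L[ℂ] H => ⟪b i, T (b i)⟫_ℂ) ((hαe i i).symm.trans (hd i))
    simpa [-InnerProductSpace.rankOne_apply, smul_apply, inner_smul_right, ent_ro] using this
  have hmul : ∀ i j, α i j = α i 0 * α 0 j := by
    intro i j
    by_cases hi : i = 0
    · rw [hi, hdiag, one_mul]
    by_cases hj : j = 0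
    · rw [hj, hdiag, mul_one]
    have hR := loc_r1 hH hΦ (b i + b 0) (b j + b 0)
    rw [ro_add_left, ro_add_right, ro_add_right, map_add, map_add, map_add, hαe, hαe, hαe,
      hαe] at hR
    have e := hR (b i) (b j) (b 0) (b 0)
    simpa [-InnerProductSpace.rankOne_apply, add_apply, inner_add_right, smul_apply,
      inner_smul_right, ent_ro, hi, hj, Ne.symm hi, Ne.symm hj, hdiag] using e
  have hinv : ∀ i, α i 0 * α 0 i = 1 := fun i => by rw [← hmul, hdiag]
  have hconj : ∀ i, starRingEnd ℂ (α i 0) * α i 0 = 1 := by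
    intro i
    rw [Complex.conj_mul', hα]; simp
  obtain ⟨d, hdb⟩ := mk_basis (v := fun n => α n 0 • b n)
    ⟨fun n => by rw [norm_smul, hα, b_norm, one_mul],
      fun n m h => by
        change ⟪α n 0 • b n, α m 0 • b m⟫_ℂ = 0
        rw [inner_smul_left, inner_smul_right, b_ne b h, mul_zero, mul_zero]⟩
    (fun z hz => basis_zero b fun n => by
      have := hz n
      rw [inner_smul_left] at this
      refine (mul_eq_zero.1 this).resolve_left ?_
      simpa using ne_zero_of_norm (hα n 0))
  have hV : ∀ i, (chg b d).symm (b i) = starRingEnd ℂ (α i 0) • b i := by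
    intro i
    rw [LinearIsometryEquiv.symm_apply_eq, map_smul, chg_apply, hdb, smul_smul, hconj, one_smul]
  apply good_of_post (lIso (chg b d).symm (chg b d))
  refine ⟨1, LinearIsometryEquiv.refl ℂ _, fun A => ?_⟩
  rw [one_smul]
  refine loc_id hH (loc_post hΦ _) ?_ A
  intro x y
  refine full_of_basis b ?_ x y
  intro i j
  change lIso (chg b d).symm (chg b d) (Φ (ro (b i) (b j))) = _
  rw [hαe, map_smul, lIso_ro, hV, hV]
  ext z
  simp only [smul_apply, InnerProductSpace.rankOne_apply, inner_smul_left, Complex.conj_conj,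
    smul_smul]
  congr 1
  rw [hmul i j]
  linear_combination ⟪b j, z⟫_ℂ * (α j 0 * α 0 j) * hconj i + ⟪b j, z⟫_ℂ * hinv j

theorem loc_good [TopologicalSpace.SeparableSpace H] (hH : ¬ FiniteDimensional ℂ H)
    (hΦ : Loc Φ) : Good Φ := by
  obtain ⟨b⟩ := exists_nat_basis (H := H) hH
  by_cases h0 : Φ (ro (b 0) (b 0)) = 0
  · have : Φ = 0 := by
      refine loc_zero hH hΦ fun x y => ?_
      by_cases hx : x = 0
      · have : ro x y = 0 := by rw [hx]; ext; simp
        rw [this, map_zero]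
      by_cases hy : y = 0
      · have : ro x y = 0 := by rw [hy]; ext; simp
        rw [this, map_zero]
      obtain ⟨s, hs0, hs⟩ := exists_normalize hx
      obtain ⟨t, ht0, ht⟩ := exists_normalize hy
      have h1 : ro (s • x) (t • y) = (s * starRingEnd ℂ t) • ro x y := by
        ext z
        simp only [smul_apply, InnerProductSpace.rankOne_apply, inner_smul_left]
        module
      have h2 : s * starRingEnd ℂ t ≠ 0 := mul_ne_zero hs0 (by simpa using ht0)
      have h3 := loc_const hH hΦ hs ht (b_norm b 0) (b_norm b 0)
      rw [h0, norm_zero, norm_eq_zero, h1, map_smul] at h3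
      exact (smul_eq_zero.1 h3).resolve_left h2
    refine ⟨0, LinearIsometryEquiv.refl ℂ _, fun A => ?_⟩
    rw [this, zero_smul]; rfl
  · obtain ⟨Ψ, hΨ, hd, hg⟩ := step_one hH hΦ b h0
    apply hg
    obtain ⟨α, hα, h | h⟩ := loc_unit hH hΨ b hd (i := 0) (j := 1) (by norm_num)
    · exact good_of_fx hH hΨ b hd ⟨α, hα, h⟩
    · apply good_of_post (trIso b)
      refine good_of_fx hH (loc_post hΨ _) b ?_ ⟨α, hα, ?_⟩
      · intro n
        change trIso b (Ψ _) = _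
        rw [hd, trIso_ro]
      · change trIso b (Ψ _) = _
        rw [h, map_smul, trIso_ro]

end Part4
end LocIso

/-- If `Φ : B(H) → B(H)` is a bounded linear map such that each
`Φ(A)` is a scalar multiple of a surjective linear isometry applied to `A`, then `Φ`
is globally a scalar multiple of a surjective linear isometry of `B(H)`. -/
theorem local_scalar_multiple_of_isometry
    {H : Type*} [NormedAddCommGroup H] [InnerProductSpace ℂ H] [CompleteSpace H]
    [TopologicalSpace.SeparableSpace H] (hH : ¬ FiniteDimensional ℂ H)
    (Φ : (H →L[ℂ] H) →L[ℂ] (H →L[ℂ] H))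
    (hΦ : ∀ A : H →L[ℂ] H, ∃ (lamA : ℂ) (τA : (H →L[ℂ] H) → (H →L[ℂ] H)),
      IsSurjectiveLinearIsometry τA ∧ Φ A = lamA • τA A) :
    ∃ (lam : ℂ) (τ : (H →L[ℂ] H) → (H →L[ℂ] H)),
      IsSurjectiveLinearIsometry τ ∧ ∀ A : H →L[ℂ] H, Φ A = lam • τ A := by
  have hloc : LocIso.Loc Φ := by
    intro A
    obtain ⟨l, τ, ⟨h1, h2, h3⟩, e⟩ := hΦ A
    let L : (H →L[ℂ] H) →ₗᵢ[ℂ] (H →L[ℂ] H) := ⟨h1.mk' τ, h3⟩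
    exact ⟨l, LinearIsometryEquiv.ofSurjective L h2, e⟩
  obtain ⟨l, τ, h⟩ := LocIso.loc_good hH hloc
  refine ⟨l, τ, ⟨⟨map_add τ, fun c x => map_smul τ c x⟩, τ.surjective, τ.norm_map⟩, h⟩
end

section
/- Let A and B be C*-algebras and let φ : A → B be a surjective linear map satisfying the triple identity φ(a b* c) + φ(c b* a) = φ(a)φ(b)*φ(c) + φ(c)φ(b)*φ(a) for all a, b, c ∈ A. Then for every closed two-sided ideal I of A, the image φ(I) is a closed two-sided ideal of B; in particular, φ maps closed two-sided ideals onto closed two-sided ideals. -/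
open Filter Topology

/-- Approximate units, without reference to an order. -/
lemma th_exists_au (A : Type*) [NonUnitalCStarAlgebra A] :
    ∃ l : Filter A, l.NeBot ∧ (∀ᶠ e in l, star e = e) ∧ (∀ᶠ e in l, ‖e‖ ≤ 1) ∧
      (∀ m : A, Tendsto (fun e => m * e) l (𝓝 m)) ∧ (∀ m : A, Tendsto (fun e => e * m) l (𝓝 m)) := by
  let := CStarAlgebra.spectralOrder A
  have := CStarAlgebra.spectralOrderedRing A
  have h := CStarAlgebra.increasingApproximateUnit A
  refine ⟨_, h.neBot, h.eventually_star_eq, h.eventually_norm, ?_, ?_⟩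
  · intro m; exact h.tendsto_mul_left m
  · intro m; exact h.tendsto_mul_right m

lemma th_mul {A : Type*} [NonUnitalCStarAlgebra A] {h : A} (_hsa : IsSelfAdjoint h) {f g : ℝ → ℝ}
    (hf : Continuous f) (hg : Continuous g) (hf0 : f 0 = 0) (hg0 : g 0 = 0) :
    cfcₙ (fun t => f t * g t) h = cfcₙ f h * cfcₙ g h :=
  cfcₙ_mul f g h hf.continuousOn hf0 hg.continuousOn hg0

lemma th_sub {A : Type*} [NonUnitalCStarAlgebra A] {h : A} (_hsa : IsSelfAdjoint h) {f g : ℝ → ℝ}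
    (hf : Continuous f) (hg : Continuous g) (hf0 : f 0 = 0) (hg0 : g 0 = 0) :
    cfcₙ (fun t => f t - g t) h = cfcₙ f h - cfcₙ g h :=
  cfcₙ_sub f g h hf.continuousOn hf0 hg.continuousOn hg0

lemma th_approx_sa {A : Type*} [NonUnitalCStarAlgebra A] {h : A} (hsa : IsSelfAdjoint h)
    {δ : ℝ} (hδ : 0 < δ) :
    ∃ w : A, star w = w ∧ h * w = w * h ∧
      ‖(h - h * (h * w)) - (h - h * (h * w)) * (h * w)‖ ≤ δ := by
  have hp : ∀ t : ℝ, t ^ 2 + δ ^ 2 ≠ 0 := fun t => by positivity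
  obtain ⟨f, hfd⟩ : ∃ f : ℝ → ℝ, f = fun t => t / (t ^ 2 + δ ^ 2) := ⟨_, rfl⟩
  have hf : Continuous f := by
    rw [hfd]; exact continuous_id.div (by fun_prop) hp
  have hf0 : f 0 = 0 := by simp [hfd]
  have i : cfcₙ (fun t : ℝ => t) h = h := cfcₙ_id' ℝ h
  have e1 : cfcₙ (fun t : ℝ => t * f t) h = h * cfcₙ f h := by
    rw [th_mul hsa continuous_id' hf rfl hf0, i]
  have e2 : cfcₙ (fun t : ℝ => t * f t) h = cfcₙ f h * h := by
    rw [show (fun t : ℝ => t * f t) = fun t => f t * t from funext fun t => mul_comm _ _,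
      th_mul hsa hf continuous_id' hf0 rfl, i]
  have c1 : Continuous (fun t : ℝ => t * f t) := continuous_id.mul hf
  have e3 : cfcₙ (fun t : ℝ => t * (t * f t)) h = h * (h * cfcₙ f h) := by
    rw [th_mul hsa continuous_id' c1 rfl (by simp), i, e1]
  have c3 : Continuous (fun t : ℝ => t * (t * f t)) := continuous_id.mul c1
  have e4 : cfcₙ (fun t : ℝ => t - t * (t * f t)) h = h - h * (h * cfcₙ f h) := by
    rw [th_sub hsa continuous_id' c3 rfl (by simp), i, e3]
  have c4 : Continuous (fun t : ℝ => t - t * (t * f t)) := continuous_id.sub c3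
  have e5 : cfcₙ (fun t : ℝ => (t - t * (t * f t)) * (t * f t)) h
      = (h - h * (h * cfcₙ f h)) * (h * cfcₙ f h) := by
    rw [th_mul hsa c4 c1 (by simp) (by simp), e4, e1]
  refine ⟨cfcₙ f h, (cfcₙ_predicate f h : IsSelfAdjoint _), e1.symm.trans e2, ?_⟩
  have c5 : Continuous (fun t : ℝ => (t - t * (t * f t)) * (t * f t)) := c4.mul c1
  rw [← e5, ← e4, ← th_sub hsa c4 c5 (by simp) (by simp)]
  refine norm_cfcₙ_le fun t _ => ?_
  have : (t - t * (t * f t)) - (t - t * (t * f t)) * (t * f t)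
      = t * δ ^ 4 / (t ^ 2 + δ ^ 2) ^ 2 := by
    rw [hfd]; have := hp t; field_simp; ring
  rw [this, Real.norm_eq_abs, abs_div,
    abs_of_nonneg (by positivity : (0:ℝ) ≤ (t ^ 2 + δ ^ 2) ^ 2),
    div_le_iff₀ (by have := hp t; positivity), abs_mul,
    abs_of_nonneg (by positivity : (0:ℝ) ≤ δ ^ 4)]
  have h1 : |t| * δ ≤ |t| ^ 2 + δ ^ 2 := by nlinarith [sq_nonneg (|t| - δ), abs_nonneg t]
  rw [← sq_abs t]
  have h2 : δ ^ 2 ≤ |t| ^ 2 + δ ^ 2 := by nlinarith [sq_nonneg (|t|)]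
  calc |t| * δ ^ 4 = δ * ((|t| * δ) * δ ^ 2) := by ring
    _ ≤ δ * ((|t| ^ 2 + δ ^ 2) * (|t| ^ 2 + δ ^ 2)) := by gcongr
    _ = _ := by ring

/-- `x` is a limit of elements `x x* x w`. -/
lemma th_approx {A : Type*} [NonUnitalCStarAlgebra A] (x : A) {η : ℝ} (hη : 0 < η) :
    ∃ w : A, ‖x - x * (star x * x * w)‖ ≤ η := by
  obtain ⟨w, hw, hc, hn⟩ := th_approx_sa (IsSelfAdjoint.star_mul_self x)
    (by positivity : 0 < η ^ 2)
  refine ⟨w, ?_⟩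
  have hse : star (star x * x * w) = star x * x * w := by
    rw [hc]; simp [hw, hc]
  have : ‖x - x * (star x * x * w)‖ ^ 2 ≤ η ^ 2 := by
    rw [sq, ← CStarRing.norm_star_mul_self]
    convert hn using 2
    have hc2 : star x * x * w * (star x * x) = star x * x * (star x * x * w) := by
      rw [mul_assoc (star x * x) w, ← hc]
    rw [star_sub, star_mul, hse]
    generalize star x * x * w = e at *
    calc (star x - e * star x) * (x - x * e)
        = star x * x - star x * x * e - (e * (star x * x) - e * (star x * x) * e) := by
          noncomm_ring
      _ = _ := by rw [hc2]; noncomm_ring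
  exact (sq_le_sq₀ (norm_nonneg _) hη.le).1 this

lemma th_bump {B : Type*} [NonUnitalCStarAlgebra B] (y c : B) (hy : ‖y‖ = 1)
    (h : c + c - (y * star y * c + c * (y * star y)) = y * star y + y * star y) : False := by
  let := CStarAlgebra.spectralOrder B
  have := CStarAlgebra.spectralOrderedRing B
  have hsa : IsSelfAdjoint (y * star y) := IsSelfAdjoint.mul_star_self y
  have hpos : 0 ≤ y * star y := mul_star_self_nonneg y
  have hn : ‖y * star y‖ = 1 := by rw [CStarRing.norm_self_mul_star, hy, one_mul]
  generalize y * star y = k at *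
  have hle : ∀ t ∈ quasispectrum ℝ k, 0 ≤ t ∧ t ≤ 1 := fun t ht =>
    ⟨quasispectrum_nonneg_of_nonneg k hpos t ht, by
      have := NonUnitalIsometricContinuousFunctionalCalculus.norm_quasispectrum_le k ht
      rw [hn, Real.norm_eq_abs] at this
      exact (le_abs_self t).trans this⟩
  have hone : (1 : ℝ) ∈ quasispectrum ℝ k := by
    obtain ⟨t, ht, hte⟩ := (NonUnitalIsometricContinuousFunctionalCalculus.isGreatest_norm_quasispectrum (𝕜 := ℝ) k).1
    simp only [hn, Real.norm_eq_abs] at hte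
    rw [abs_of_nonneg (hle t ht).1] at hte
    rwa [← hte]
  obtain ⟨ε, hε, hε1, hεc⟩ : ∃ ε : ℝ, 0 < ε ∧ ε ≤ 1 ∧ ε * ‖c‖ < 1 := by
    refine ⟨1 / (‖c‖ + 1), by positivity, ?_, ?_⟩
    · rw [div_le_one (by positivity)]; linarith [norm_nonneg c]
    · rw [div_mul_eq_mul_div, div_lt_one (by positivity)]; linarith
  obtain ⟨f, hfd⟩ : ∃ f : ℝ → ℝ, f = fun t => max 0 (1 - (1 - t) / ε) := ⟨_, rfl⟩
  have hf : Continuous f := by rw [hfd]; fun_prop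
  have hfnn : ∀ t, 0 ≤ f t := fun t => by rw [hfd]; exact le_max_left _ _
  have c1 : Continuous (fun t : ℝ => t * f t) := continuous_id.mul hf
  have hf0 : f 0 = 0 := by
    simp only [hfd, sub_zero, max_eq_left_iff, sub_nonpos]
    rw [le_div_iff₀ hε]; linarith
  have hf1 : f 1 = 1 := by simp [hfd]
  let F := cfcₙ f k
  have hFn : ‖F‖ ≤ 1 := by
    refine norm_cfcₙ_le fun t ht => ?_
    have h1 := (hle t ht).2
    rw [Real.norm_eq_abs, abs_of_nonneg (hfnn _)]
    rw [hfd]; apply max_le zero_le_one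
    have : 0 ≤ (1 - t) / ε := div_nonneg (by linarith) hε.le
    linarith
  have hid : cfcₙ (fun t : ℝ => t) k = k := cfcₙ_id' ℝ k
  have hb : ∀ t ∈ quasispectrum ℝ k, ‖f t - t * f t‖ ≤ ε := by
    intro t ht
    have h1 := (hle t ht).2
    rw [show f t - t * f t = (1 - t) * f t by ring, Real.norm_eq_abs, abs_mul,
      abs_of_nonneg (by linarith), abs_of_nonneg (hfnn _)]
    by_cases h2 : 1 - t ≤ ε
    · have : f t ≤ 1 := by
        rw [hfd]; apply max_le zero_le_one
        have : 0 ≤ (1 - t) / ε := div_nonneg (by linarith) hε.le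
        linarith
      calc (1 - t) * f t ≤ ε * 1 := by
            apply mul_le_mul h2 this (hfnn _) hε.le
        _ = ε := mul_one _
    · have : f t = 0 := by
        rw [hfd]; apply max_eq_left
        rw [sub_nonpos, le_div_iff₀ hε]; linarith
      rw [this]; linarith
  have hFk : cfcₙ (fun t : ℝ => t * f t) k = k * F := by
    rw [th_mul hsa continuous_id' hf rfl hf0, hid]
  have hkF : k * F = F * k := by
    rw [← hFk, show (fun t : ℝ => t * f t) = fun t => f t * t from funext fun t => mul_comm _ _,
      th_mul hsa hf continuous_id' hf0 rfl, hid]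
  have hL : ‖F - k * F‖ ≤ ε := by
    rw [← hFk, ← th_sub hsa hf c1 hf0 (by simp)]
    exact norm_cfcₙ_le hb
  have hbig : 1 ≤ ‖F * (k * F)‖ := by
    rw [← hFk, ← th_mul hsa hf c1 hf0 (by simp)]
    have := norm_apply_le_norm_cfcₙ (fun t => f t * (t * f t)) k hone (hf.mul c1).continuousOn (by simp)
    simpa [hf1] using this
  have heq : F * (k * F) + F * (k * F) = (F - k * F) * c * F + F * c * (F - k * F) := by
    have : F * (k + k) * F = F * (c + c - (k * c + c * k)) * F := by rw [h]
    calc F * (k * F) + F * (k * F) = F * (k + k) * F := by noncomm_ring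
      _ = _ := this
      _ = (F - F * k) * c * F + F * c * (F - k * F) := by noncomm_ring
      _ = _ := by rw [← hkF]
  have h2 : ‖F * (k * F) + F * (k * F)‖ = 2 * ‖F * (k * F)‖ := by
    rw [← two_smul ℝ, norm_smul]; simp
  have h3 : ‖(F - k * F) * c * F‖ ≤ ε * ‖c‖ := by
    calc _ ≤ ‖F - k * F‖ * ‖c‖ * ‖F‖ := by
          refine (norm_mul_le _ _).trans ?_; gcongr; exact norm_mul_le _ _
      _ ≤ ε * ‖c‖ * 1 := by gcongr
      _ = _ := mul_one _
  have h4 : ‖F * c * (F - k * F)‖ ≤ ε * ‖c‖ := by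
    calc _ ≤ ‖F‖ * ‖c‖ * ‖F - k * F‖ := by
          refine (norm_mul_le _ _).trans ?_; gcongr; exact norm_mul_le _ _
      _ ≤ 1 * ‖c‖ * ε := by gcongr
      _ = _ := by ring
  have h5 := norm_add_le ((F - k * F) * c * F) (F * c * (F - k * F))
  rw [← heq, h2] at h5
  linarith

/-- Triple homomorphisms are contractive. -/
lemma th_contr {A B : Type*} [NonUnitalCStarAlgebra A] [NonUnitalCStarAlgebra B]
    (φ : A →ₗ[ℂ] B)
    (htriple : ∀ a b c : A,
      φ (a * star b * c) + φ (c * star b * a) =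
        φ a * star (φ b) * φ c + φ c * star (φ b) * φ a) (x : A) : ‖φ x‖ ≤ ‖x‖ := by
  by_contra! hlt
  obtain ⟨z, hz, hz1⟩ : ∃ z : A, ‖z‖ < 1 ∧ ‖φ z‖ = 1 := by
    have hpos : 0 < ‖φ x‖ := (norm_nonneg _).trans_lt hlt
    refine ⟨((‖φ x‖⁻¹ : ℝ) : ℂ) • x, ?_, ?_⟩
    · rw [norm_smul, Complex.norm_real, norm_inv, norm_norm, inv_mul_lt_iff₀ hpos]
      simpa using hlt
    · rw [map_smul, norm_smul, Complex.norm_real, norm_inv, norm_norm, inv_mul_cancel₀ hpos.ne']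
  let T : A →L[ℂ] A := ContinuousLinearMap.mul ℂ A (z * star z)
  have hT : ‖T‖ < 1 := by
    refine (ContinuousLinearMap.opNorm_mul_apply_le ℂ A _).trans_lt ?_
    rw [CStarRing.norm_self_mul_star]
    nlinarith [norm_nonneg z]
  obtain ⟨u, hu⟩ := isUnit_one_sub_of_norm_lt_one hT
  have hu1 : ∀ v, (u : A →L[ℂ] A) v = v - z * star z * v := fun v => by rw [hu]; rfl
  have hinj : Function.Injective (u : A →L[ℂ] A) := fun v w hvw => by
    have := congrArg (fun q => (↑u⁻¹ : A →L[ℂ] A) q) hvw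
    simpa [← mul_apply_eq_comp] using this
  let a := (↑u⁻¹ : A →L[ℂ] A) z
  have ha : a - z * star z * a = z := by
    rw [← hu1]; simp [a, ← mul_apply_eq_comp]
  have hc : z * star z * a = a * star z * z := by
    apply hinj
    rw [hu1, hu1]
    calc z * star z * a - z * star z * (z * star z * a)
        = z * star z * (a - z * star z * a) := by noncomm_ring
      _ = (a - z * star z * a) * star z * z := by rw [ha]
      _ = _ := by noncomm_ring
  have ht := htriple z z a
  have hza : z * star z * a = a - z := by
    rw [eq_sub_iff_add_eq, add_comm]; exact (sub_eq_iff_eq_add.1 ha).symm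
  rw [← hc, hza, map_sub] at ht
  refine th_bump (φ z) (φ a * star (φ z)) hz1 ?_
  have : φ a + φ a - (φ z * star (φ z) * φ a + φ a * star (φ z) * φ z) = φ z + φ z := by
    rw [← ht]; abel
  calc _ = (φ a + φ a - (φ z * star (φ z) * φ a + φ a * star (φ z) * φ z)) * star (φ z) := by
        noncomm_ring
    _ = _ := by rw [this, add_mul]

/-- Closed triple ideals are two-sided ideals. -/
lemma th_ideal {B : Type*} [NonUnitalCStarAlgebra B] (J : Submodule ℂ B)
    (hJ : IsClosed (J : Set B))
    (h1 : ∀ x ∈ J, ∀ b c : B, x * star b * c + c * star b * x ∈ J)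
    (h2 : ∀ x ∈ J, ∀ b c : B, b * star x * c + c * star x * b ∈ J) :
    ∀ x ∈ J, ∀ b : B, x * b ∈ J ∧ b * x ∈ J := by
  obtain ⟨l, hl, hls, hl1, hlr, hll⟩ := th_exists_au B
  have half : ∀ u : B, u + u ∈ J → u ∈ J := fun u hu => by
    have : u = (2⁻¹ : ℂ) • (u + u) := by rw [← two_smul ℂ u, smul_smul]; simp
    rw [this]; exact J.smul_mem _ hu
  -- self-adjointness
  have hstar : ∀ x ∈ J, star x ∈ J := by
    intro x hx
    have ht : Tendsto (fun e => star x * e) l (𝓝 (star x)) := hlr _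
    have hmem : ∀ b : B, b * star x * b ∈ J := fun b => half _ (h2 x hx b b)
    have ht2 : Tendsto (fun e => e * star x * e) l (𝓝 (star x)) := by
      have hz : Tendsto (fun e => e * (star x * e - star x)) l (𝓝 0) := by
        refine squeeze_zero_norm' (a := fun e => ‖star x * e - star x‖) ?_ ?_
        · filter_upwards [hl1] with e he
          calc _ ≤ ‖e‖ * ‖star x * e - star x‖ := norm_mul_le _ _
            _ ≤ 1 * ‖star x * e - star x‖ := by gcongr
            _ = _ := one_mul _
        · simpa using (ht.sub_const (star x)).norm
      have := hz.add (hll (star x))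
      simp only [zero_add] at this
      refine this.congr fun e => ?_
      noncomm_ring
    exact hJ.mem_of_tendsto ht2 (Eventually.of_forall fun e => hmem e)
  -- Jordan ideal
  have hjord : ∀ x ∈ J, ∀ b : B, x * b + b * x ∈ J := by
    intro x hx b
    have ht : Tendsto (fun e => x * e * b + b * (e * x)) l (𝓝 (x * b + b * x)) :=
      ((hlr x).mul_const b).add ((hll x).const_mul b)
    refine hJ.mem_of_tendsto ht ?_
    filter_upwards [hls] with e he
    have := h1 x hx e b
    rwa [he, mul_assoc b e x] at this
  have hsq : ∀ x ∈ J, ∀ b : B, x * x * b ∈ J ∧ b * (x * x) ∈ J := by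
    intro x hx b
    have hxx : x * x ∈ J := half _ (hjord x hx x)
    have ha := hjord _ hxx b
    have hb := hjord x hx (x * b - b * x)
    constructor
    · apply half
      have := J.add_mem ha hb
      convert this using 1; noncomm_ring
    · apply half
      have := J.sub_mem ha hb
      convert this using 1; noncomm_ring
  have hsq2 : ∀ x ∈ J, ∀ b c : B, b * (x * x) * c ∈ J := by
    intro x hx b c
    have ha := hjord _ (hsq x hx b).2 c
    have hb := (hsq x hx (c * b)).2
    have := J.sub_mem ha hb
    convert this using 1; noncomm_ring
  have hsa : ∀ x ∈ J, star x = x → ∀ b : B, x * b ∈ J ∧ b * x ∈ J := by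
    intro x hx hxs b
    have key : ∀ n : ℕ, ∃ w : B, ‖x - x * x * (x * w)‖ ≤ 1 / ((n : ℝ) + 1) := fun n => by
      obtain ⟨w, hw⟩ := th_approx x (by positivity : 0 < 1 / ((n : ℝ) + 1))
      refine ⟨w, ?_⟩
      rw [hxs] at hw
      convert hw using 3; noncomm_ring
    choose w hw using key
    have ht : Tendsto (fun n => x * x * (x * w n)) atTop (𝓝 x) := by
      rw [tendsto_iff_norm_sub_tendsto_zero]
      refine squeeze_zero (fun _ => norm_nonneg _) (fun n => ?_) tendsto_one_div_add_atTop_nhds_zero_nat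
      rw [norm_sub_rev]; exact hw n
    constructor
    · refine hJ.mem_of_tendsto (ht.mul_const b) (Eventually.of_forall fun n => ?_)
      change x * x * (x * w n) * b ∈ J
      rw [mul_assoc (x * x)]
      exact (hsq x hx _).1
    · refine hJ.mem_of_tendsto (ht.const_mul b) (Eventually.of_forall fun n => ?_)
      change b * (x * x * (x * w n)) ∈ J
      rw [← mul_assoc b]
      exact hsq2 x hx _ _
  intro x hx b
  have hs := hstar x hx
  have a1 := hsa (x + star x) (J.add_mem hx hs) (by simp [add_comm]) b
  have a2 := hsa (Complex.I • (x - star x)) (J.smul_mem _ (J.sub_mem hx hs))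
    (by simp [star_smul, smul_sub]; abel) b
  have a3 : (x - star x) * b ∈ J ∧ b * (x - star x) ∈ J := by
    have h3 := J.smul_mem (-Complex.I) a2.1
    have h4 := J.smul_mem (-Complex.I) a2.2
    rw [smul_mul_assoc, smul_smul] at h3
    rw [mul_smul_comm, smul_smul] at h4
    simp only [neg_mul, Complex.I_mul_I, neg_neg, one_smul] at h3 h4
    exact ⟨h3, h4⟩
  constructor
  · apply half
    convert J.add_mem a1.1 a3.1 using 1; noncomm_ring
  · apply half
    convert J.add_mem a1.2 a3.2 using 1; noncomm_ring

lemma th_smul_mem {A : Type*} [NonUnitalCStarAlgebra A] (I : TwoSidedIdeal A)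
    (hI : IsClosed (I : Set A)) (c : ℂ) {x : A} (hx : x ∈ I) : c • x ∈ I := by
  obtain ⟨l, hl, hls, hl1, hlr, hll⟩ := th_exists_au A
  refine hI.mem_of_tendsto ((hll x).const_smul c) (Eventually.of_forall fun e => ?_)
  change c • (e * x) ∈ I
  rw [← smul_mul_assoc]
  exact I.mul_mem_left _ _ hx

lemma th_star_mem {A : Type*} [NonUnitalCStarAlgebra A] (I : TwoSidedIdeal A)
    (hI : IsClosed (I : Set A)) {x : A} (hx : x ∈ I) : star x ∈ I := by
  have key : ∀ n : ℕ, ∃ w : A, ‖x - x * (star x * x * w)‖ ≤ 1 / ((n : ℝ) + 1) := fun n =>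
    th_approx x (by positivity : 0 < 1 / ((n : ℝ) + 1))
  choose w hw using key
  have ht : Tendsto (fun n => star (x * (star x * x * w n))) atTop (𝓝 (star x)) := by
    rw [tendsto_iff_norm_sub_tendsto_zero]
    refine squeeze_zero (fun _ => norm_nonneg _) (fun n => ?_) tendsto_one_div_add_atTop_nhds_zero_nat
    rw [← star_sub, norm_star, norm_sub_rev]; exact hw n
  refine hI.mem_of_tendsto ht (Eventually.of_forall fun n => ?_)
  change star (x * (star x * x * w n)) ∈ I
  have : star (x * (star x * x * w n)) = star (w n) * star x * x * star x := by
    simp [mul_assoc]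
  rw [this]
  exact I.mul_mem_right _ _ (I.mul_mem_left _ _ hx)

lemma th_ideal_au {A : Type*} [NonUnitalCStarAlgebra A] (I : TwoSidedIdeal A)
    (hI : IsClosed (I : Set A)) {x : A} (hx : x ∈ I) {δ : ℝ} (hδ : 0 < δ) :
    ∃ e ∈ I, star e = e ∧ ‖e‖ ≤ 1 ∧ ‖x - x * e‖ ≤ δ ∧ ‖x - e * x‖ ≤ δ := by
  let S : NonUnitalStarSubalgebra ℂ A :=
    { carrier := (I : Set A)
      add_mem' := fun ha hb => I.add_mem ha hb
      zero_mem' := I.zero_mem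
      mul_mem' := fun {a b} _ hb => I.mul_mem_left a b hb
      smul_mem' := fun c _ hx => th_smul_mem I hI c hx
      star_mem' := fun hx => th_star_mem I hI hx }
  have : IsClosed (S : Set A) := hI
  obtain ⟨l, hl, hls, hl1, hlr, hll⟩ := th_exists_au S
  have e1 := (Metric.tendsto_nhds.1 (hlr ⟨x, hx⟩)) δ hδ
  have e2 := (Metric.tendsto_nhds.1 (hll ⟨x, hx⟩)) δ hδ
  obtain ⟨e, he1, he2, he3, he4⟩ := (e1.and (e2.and (hls.and hl1))).exists
  refine ⟨e, e.2, congrArg Subtype.val he3, he4, ?_, ?_⟩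
  · rw [dist_comm, dist_eq_norm] at he1; exact he1.le
  · rw [dist_comm, dist_eq_norm] at he2; exact he2.le

theorem triple_hom_image_of_closed_ideal
    {A B : Type*} [NonUnitalCStarAlgebra A] [NonUnitalCStarAlgebra B]
    (φ : A → B) (hlin : IsLinearMap ℂ φ) (hsurj : Function.Surjective φ)
    (htriple : ∀ a b c : A,
      φ (a * star b * c) + φ (c * star b * a) =
        φ a * star (φ b) * φ c + φ c * star (φ b) * φ a)
    (I : TwoSidedIdeal A) (hI : IsClosed (I : Set A)) :
    ∃ J : TwoSidedIdeal B, IsClosed (J : Set B) ∧ (J : Set B) = φ '' (I : Set A) := by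
  let L : A →ₗ[ℂ] B := hlin.mk' φ
  have hcon : ∀ x, ‖L x‖ ≤ 1 * ‖x‖ := fun x => by
    rw [one_mul]; exact th_contr L htriple x
  let F : A →L[ℂ] B := L.mkContinuous 1 hcon
  obtain ⟨C, hC, hF⟩ := F.exists_preimage_norm_le hsurj
  let I' : Submodule ℂ A :=
    { carrier := (I : Set A)
      add_mem' := fun ha hb => I.add_mem ha hb
      zero_mem' := I.zero_mem
      smul_mem' := fun c _ hx => th_smul_mem I hI c hx }
  have hmemI : ∀ x, x ∈ I' ↔ x ∈ I := fun x => Iff.rfl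
  have hI'c : IsClosed (I' : Set A) := hI
  have : CompleteSpace I' := hI'c.completeSpace_coe
  let J : Submodule ℂ B := I'.map L
  have hJs : (J : Set B) = φ '' (I : Set A) := rfl
  have hJ : IsClosed (J : Set B) := by
    let f : NormedAddGroupHom I' B :=
      (L.comp I'.subtype).toAddMonoidHom.mkNormedAddGroupHom 1 (fun x => hcon x)
    have hfv : ∀ x : I', f x = L x := fun x => rfl
    have hs : f.SurjectiveOnWith J.toAddSubgroup (C + 1) := by
      rintro _ ⟨i, hi, rfl⟩
      by_cases h0 : L i = 0
      · exact ⟨0, by simp [h0], by simp [h0]⟩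
      have hpos : 0 < ‖L i‖ := norm_pos_iff.2 h0
      obtain ⟨a, ha, han⟩ := hF (L i)
      obtain ⟨e, heI, hes, hen, he1, he2⟩ := th_ideal_au I hI hi (half_pos hpos)
      have hLe : L (a * e * e + e * e * a) = L (i * e * e + e * e * i) := by
        have t1 := htriple a e e
        have t2 := htriple i e e
        rw [hes] at t1 t2
        rw [map_add, map_add]
        change φ _ + φ _ = φ _ + φ _
        rw [t1, t2, show φ a = φ i from ha]
      let i' : A := (2⁻¹ : ℂ) • (a * e * e + e * e * a) +
        (i - (2⁻¹ : ℂ) • (i * e * e + e * e * i))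
      have hi' : i' ∈ I' := by
        refine I'.add_mem (I'.smul_mem _ (I'.add_mem ?_ ?_))
          (I'.sub_mem hi (I'.smul_mem _ (I'.add_mem ?_ ?_)))
        · exact I.mul_mem_left _ _ heI
        · exact I.mul_mem_right _ _ (I.mul_mem_left _ _ heI)
        · exact I.mul_mem_left _ _ heI
        · exact I.mul_mem_right _ _ (I.mul_mem_left _ _ heI)
      refine ⟨⟨i', hi'⟩, ?_, ?_⟩
      · rw [hfv]
        change L i' = L i
        simp only [i', map_add L (_ • _), map_sub, map_smul, hLe]
        abel
      · change ‖i'‖ ≤ _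
        have n1 : ‖a * e * e‖ ≤ ‖a‖ := by
          calc _ ≤ ‖a‖ * ‖e‖ * ‖e‖ := by
                refine (norm_mul_le _ _).trans ?_; gcongr; exact norm_mul_le _ _
            _ ≤ ‖a‖ * 1 * 1 := by gcongr
            _ = _ := by ring
        have n2 : ‖e * e * a‖ ≤ ‖a‖ := by
          calc _ ≤ ‖e‖ * ‖e‖ * ‖a‖ := by
                refine (norm_mul_le _ _).trans ?_; gcongr; exact norm_mul_le _ _
            _ ≤ 1 * 1 * ‖a‖ := by gcongr
            _ = _ := by ring
        have n3 : ‖i - i * e * e‖ ≤ ‖L i‖ := by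
          calc _ = ‖(i - i * e) + (i - i * e) * e‖ := by congr 1; noncomm_ring
            _ ≤ ‖i - i * e‖ + ‖i - i * e‖ * ‖e‖ :=
                (norm_add_le _ _).trans (by gcongr; exact norm_mul_le _ _)
            _ ≤ ‖L i‖ / 2 + ‖L i‖ / 2 * 1 := by gcongr
            _ = _ := by ring
        have n4 : ‖i - e * e * i‖ ≤ ‖L i‖ := by
          calc _ = ‖(i - e * i) + e * (i - e * i)‖ := by congr 1; noncomm_ring
            _ ≤ ‖i - e * i‖ + ‖e‖ * ‖i - e * i‖ :=
                (norm_add_le _ _).trans (by gcongr; exact norm_mul_le _ _)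
            _ ≤ ‖L i‖ / 2 + 1 * (‖L i‖ / 2) := by gcongr
            _ = _ := by ring
        have hi'e : i' = (2⁻¹ : ℂ) •
            ((a * e * e + e * e * a) + ((i - i * e * e) + (i - e * e * i))) := by
          have : i = (2⁻¹ : ℂ) • (i + i) := by rw [← two_smul ℂ i, smul_smul]; simp
          calc i' = (2⁻¹ : ℂ) • (a * e * e + e * e * a) +
                ((2⁻¹ : ℂ) • (i + i) - (2⁻¹ : ℂ) • (i * e * e + e * e * i)) := by rw [← this]
            _ = _ := by rw [← smul_sub, ← smul_add]; congr 1; abel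
        rw [hi'e, norm_smul]
        have m1 := norm_add_le (a * e * e + e * e * a) ((i - i * e * e) + (i - e * e * i))
        have m2 := norm_add_le (a * e * e) (e * e * a)
        have m3 := norm_add_le (i - i * e * e) (i - e * e * i)
        have m4 : ‖(2⁻¹ : ℂ)‖ = 2⁻¹ := by simp
        rw [m4]
        linarith
    have hs2 := controlled_closure_of_complete (ε := 1) (by positivity) one_pos hs
    have : closure (J : Set B) ⊆ J := by
      intro y hy
      obtain ⟨g, hg, -⟩ := hs2 y hy
      rw [← hg]
      exact ⟨g, g.2, rfl⟩
    exact isClosed_of_closure_subset this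
  have hid := th_ideal J hJ
    (by
      rintro _ ⟨i, hi, rfl⟩ b c
      obtain ⟨b, rfl⟩ := hsurj b
      obtain ⟨c, rfl⟩ := hsurj c
      refine ⟨i * star b * c + c * star b * i, ?_, ?_⟩
      · exact I.add_mem (I.mul_mem_right _ _ (I.mul_mem_right _ _ hi)) (I.mul_mem_left _ _ hi)
      · rw [map_add]; exact htriple i b c)
    (by
      rintro _ ⟨i, hi, rfl⟩ b c
      obtain ⟨b, rfl⟩ := hsurj b
      obtain ⟨c, rfl⟩ := hsurj c
      have hi2 := th_star_mem I hI hi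
      refine ⟨b * star i * c + c * star i * b, ?_, ?_⟩
      · exact I.add_mem (I.mul_mem_right _ _ (I.mul_mem_left _ _ hi2))
          (I.mul_mem_right _ _ (I.mul_mem_left _ _ hi2))
      · rw [map_add]; exact htriple b i c)
  let K : TwoSidedIdeal B := TwoSidedIdeal.mk' (J : Set B) J.zero_mem
    (fun ha hb => J.add_mem ha hb) (fun ha => J.neg_mem ha)
    (fun {x y} hy => (hid y hy x).2) (fun {x y} hx => (hid x hx y).1)
  have hK : (K : Set B) = J := by
    ext y; exact TwoSidedIdeal.mem_mk' _ _ _ _ _ _ _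
  exact ⟨K, hK ▸ hJ, hK.trans hJs⟩
end
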